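/- arXiv:1507.02728 — 2 statements merged into one kernel-verified Lean document; each statement's English description precedes it below -/
import Mathlib

section
/- For b, c ∈ AC_0([0,1],ℝ^d), the following are equivalent: (1) there exist a ∈ AC_0([0,1],ℝ^d) and β, γ ∈ Γ̄ such that b = a ∘ β and c = a ∘ γ; (2) the closures in AC_0 of the orbits b ∘ Γ and c ∘ Γ coincide. In particular, relation (1) defines an equivalence relation on AC_0([0,1],ℝ^d), with equivalence classes [c] equal to the closure of c ∘ Γ. -/
open MeasureTheory Set Filter
open scoped NNReal ENNReal

noncomputable section

/-- `ℝ^d` with the Euclidean norm. -/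
abbrev E (d : ℕ) := EuclideanSpace ℝ (Fin d)

/-- `V x = x / √|x|`, with `V 0 = 0` (note `Real.sqrt 0 = 0` and `0⁻¹ = 0`). -/
def V {d : ℕ} (x : E d) : E d := (Real.sqrt ‖x‖)⁻¹ • x

/-- `c` is an absolutely continuous curve on `[0,1]` with `c 0 = 0` and a.e. derivative `f`,
i.e. `c t = ∫_0^t f` on `[0,1]` with `f` integrable. -/
def IsACDeriv {d : ℕ} (c f : ℝ → E d) : Prop :=
  StronglyMeasurable f ∧ IntegrableOn f (Icc 0 1) volume ∧
    ∀ t ∈ Icc (0:ℝ) 1, c t = ∫ τ in (0:ℝ)..t, f τ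

/-- Scalar version: `γ t = ∫_0^t g` on `[0,1]` with `g` integrable. -/
def IsACDerivR (γ g : ℝ → ℝ) : Prop :=
  StronglyMeasurable g ∧ IntegrableOn g (Icc 0 1) volume ∧
    ∀ t ∈ Icc (0:ℝ) 1, γ t = ∫ τ in (0:ℝ)..t, g τ

/-- The semigroup `Γ̄` of absolutely continuous `γ : [0,1] → [0,1]` with
`γ 0 = 0`, `γ 1 = 1` and `γ' ≥ 0` a.e. -/
def MemGammaBar (γ : ℝ → ℝ) : Prop :=
  ∃ g, IsACDerivR γ g ∧ (∀ᵐ t ∂(volume.restrict (Icc (0:ℝ) 1)), 0 ≤ g t) ∧ γ 1 = 1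

/-- The group `Γ` of absolutely continuous `γ : [0,1] → [0,1]` with
`γ 0 = 0`, `γ 1 = 1` and `γ' > 0` a.e. -/
def MemGamma (γ : ℝ → ℝ) : Prop :=
  ∃ g, IsACDerivR γ g ∧ (∀ᵐ t ∂(volume.restrict (Icc (0:ℝ) 1)), 0 < g t) ∧ γ 1 = 1

/-- The AC norm `‖x‖_{AC} = ∫_0^1 ‖x'‖` of a curve `x ∈ AC₀([0,1],ℝ^d)` (and `0` if `x` is not
such a curve); well defined since the a.e. derivative is a.e. unique. -/
def ACnorm {d : ℕ} (x : ℝ → E d) : ℝ := by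
  classical exact if h : ∃ f, IsACDeriv x f then ∫ t in (0:ℝ)..1, ‖h.choose t‖ else 0

/-- The orbit `c ∘ Γ̄` of a curve under the reparametrisation semigroup `Γ̄`
(curves are compared on `[0,1]`). -/
def OrbitBar {d : ℕ} (c : ℝ → E d) : Set (ℝ → E d) :=
  {x | ∃ γ, MemGammaBar γ ∧ ∀ t ∈ Icc (0:ℝ) 1, x t = c (γ t)}

/-- The orbit `c ∘ Γ` of a curve under the reparametrisation group `Γ`. -/
def Orbit {d : ℕ} (c : ℝ → E d) : Set (ℝ → E d) :=
  {x | ∃ γ, MemGamma γ ∧ ∀ t ∈ Icc (0:ℝ) 1, x t = c (γ t)}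

/-- The closure of a set of curves inside `AC₀([0,1],ℝ^d)` with respect to the AC norm. -/
def ACClosure {d : ℕ} (S : Set (ℝ → E d)) : Set (ℝ → E d) :=
  {x | (∃ f, IsACDeriv x f) ∧ ∀ ε > (0:ℝ), ∃ y ∈ S, ACnorm (x - y) < ε}

/-- `g` is a probability density on `ℝ` that vanishes off `[0,1]`. -/
structure IsUnitDensity (g : ℝ → ℝ) : Prop where
  measurable : Measurable g
  nonneg : ∀ t, 0 ≤ g t
  eq_zero : ∀ t ∉ Icc (0:ℝ) 1, g t = 0
  integrable : Integrable g
  integral_eq : ∫ t in (0:ℝ)..1, g t = 1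

/-- The primitive of `g` vanishing at `0`. -/
def primitive (g : ℝ → ℝ) (t : ℝ) : ℝ := ∫ τ in (0:ℝ)..t, g τ

/-- The measure with Lebesgue density `g`. -/
def densityMeasure (g : ℝ → ℝ) : Measure ℝ := volume.withDensity fun t => ENNReal.ofReal (g t)

namespace IsUnitDensity

variable {g : ℝ → ℝ}

lemma intervalIntegrable (hg : IsUnitDensity g) (s t : ℝ) : IntervalIntegrable g volume s t :=
  hg.integrable.intervalIntegrable

lemma continuous_primitive (hg : IsUnitDensity g) : Continuous (primitive g) :=
  intervalIntegral.continuous_primitive hg.intervalIntegrable 0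

lemma primitive_sub (hg : IsUnitDensity g) (s t : ℝ) :
    primitive g t - primitive g s = ∫ τ in s..t, g τ :=
  intervalIntegral.integral_interval_sub_left (hg.intervalIntegrable _ _)
    (hg.intervalIntegrable _ _)

lemma monotone_primitive (hg : IsUnitDensity g) : Monotone (primitive g) := by
  intro s t hst
  rw [← sub_nonneg, hg.primitive_sub]
  exact intervalIntegral.integral_nonneg hst fun u _ => hg.nonneg u

lemma primitive_zero : primitive g 0 = 0 := by simp [primitive]

lemma primitive_one (hg : IsUnitDensity g) : primitive g 1 = 1 := hg.integral_eq

lemma primitive_of_nonpos (hg : IsUnitDensity g) {t : ℝ} (ht : t ≤ 0) : primitive g t = 0 := by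
  have h : ∫ τ in t..(0:ℝ), g τ = 0 := by
    rw [intervalIntegral.integral_of_le ht, integral_Ioc_eq_integral_Ioo]
    apply setIntegral_eq_zero_of_forall_eq_zero
    intro u hu
    exact hg.eq_zero u fun h => by linarith [h.1, hu.2]
  rw [primitive, intervalIntegral.integral_symm, h, neg_zero]

lemma primitive_of_one_le (hg : IsUnitDensity g) {t : ℝ} (ht : 1 ≤ t) : primitive g t = 1 := by
  have h : ∫ τ in (1:ℝ)..t, g τ = 0 := by
    rw [intervalIntegral.integral_of_le ht]
    apply setIntegral_eq_zero_of_forall_eq_zero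
    intro u hu
    exact hg.eq_zero u fun h => by linarith [h.2, hu.1]
  have h2 := hg.primitive_sub 1 t
  rw [h, hg.primitive_one] at h2
  linarith

lemma primitive_mem_Icc (hg : IsUnitDensity g) (t : ℝ) : primitive g t ∈ Icc (0:ℝ) 1 := by
  constructor
  · rcases le_total t 0 with h | h
    · rw [hg.primitive_of_nonpos h]
    · simpa [primitive_zero] using hg.monotone_primitive h
  · rcases le_total t 1 with h | h
    · simpa [hg.primitive_one] using hg.monotone_primitive h
    · rw [hg.primitive_of_one_le h]

lemma densityMeasure_Iic (hg : IsUnitDensity g) (t : ℝ) :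
    densityMeasure g (Iic t) = ENNReal.ofReal (primitive g t) := by
  rw [densityMeasure, withDensity_apply _ measurableSet_Iic,
    ← ofReal_integral_eq_lintegral_ofReal hg.integrable.integrableOn
      (Eventually.of_forall hg.nonneg), primitive,
    ← intervalIntegral.integral_Iic_sub_Iic hg.integrable.integrableOn hg.integrable.integrableOn]
  have h : ∫ τ in Iic (0:ℝ), g τ = 0 := by
    rw [integral_Iic_eq_integral_Iio]
    apply setIntegral_eq_zero_of_forall_eq_zero
    intro u hu
    exact hg.eq_zero u fun h => by linarith [h.1, mem_Iio.1 hu]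
  rw [h, sub_zero]

lemma isFiniteMeasure (hg : IsUnitDensity g) : IsFiniteMeasure (densityMeasure g) :=
  isFiniteMeasure_withDensity_ofReal hg.integrable.2

lemma exists_preimage_Iic (hg : IsUnitDensity g) {a : ℝ} (h0 : 0 ≤ a) (h1 : a < 1) :
    ∃ s, primitive g s = a ∧ primitive g ⁻¹' Iic a = Iic s := by
  have hne : ({t | primitive g t = a} ∩ Icc (0:ℝ) 1).Nonempty := by
    obtain ⟨t, ht, hta⟩ := intermediate_value_Icc zero_le_one hg.continuous_primitive.continuousOn
      (show a ∈ Icc (primitive g 0) (primitive g 1) by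
        rw [primitive_zero, hg.primitive_one]; exact ⟨h0, h1.le⟩)
    exact ⟨t, hta, ht⟩
  have hc : IsCompact ({t | primitive g t = a} ∩ Icc (0:ℝ) 1) :=
    isCompact_Icc.inter_left (isClosed_eq hg.continuous_primitive continuous_const)
  obtain ⟨s, ⟨hsa, hs⟩, hmax⟩ := hc.exists_isGreatest hne
  have hsa : primitive g s = a := hsa
  refine ⟨s, hsa, ?_⟩
  ext t
  simp only [mem_preimage, mem_Iic]
  constructor
  · intro hta
    by_contra! hst
    have hta' : primitive g t = a := le_antisymm hta (hsa ▸ hg.monotone_primitive hst.le)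
    have ht1 : t ≤ 1 := by
      by_contra! h
      rw [hg.primitive_of_one_le h.le] at hta'
      linarith
    exact absurd (hmax ⟨hta', hs.1.trans hst.le, ht1⟩) (not_le.2 hst)
  · intro h
    exact hsa ▸ hg.monotone_primitive h

lemma map_primitive (hg : IsUnitDensity g) :
    (densityMeasure g).map (primitive g) = volume.restrict (Icc (0:ℝ) 1) := by
  have := hg.isFiniteMeasure
  have hm := hg.continuous_primitive.measurable
  have : IsFiniteMeasure ((densityMeasure g).map (primitive g)) :=
    Measure.isFiniteMeasure_map _ _
  apply Measure.ext_of_Iic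
  intro a
  rw [Measure.map_apply hm measurableSet_Iic, Measure.restrict_apply measurableSet_Iic]
  rcases lt_or_ge a 0 with h0 | h0
  · have e1 : primitive g ⁻¹' Iic a = ∅ := by
      ext t
      simpa using h0.trans_le (hg.primitive_mem_Icc t).1
    have e2 : Iic a ∩ Icc (0:ℝ) 1 = ∅ := by
      ext t
      simp only [mem_inter_iff, mem_Iic, mem_Icc, mem_empty_iff_false, iff_false]
      rintro ⟨h, h', -⟩
      linarith
    simp [e1, e2]
  rcases lt_or_ge a 1 with h1 | h1
  · obtain ⟨s, hs, he⟩ := hg.exists_preimage_Iic h0 h1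
    have e2 : Iic a ∩ Icc (0:ℝ) 1 = Icc 0 a := by
      ext t
      simp only [mem_inter_iff, mem_Iic, mem_Icc]
      constructor
      · rintro ⟨h, h', -⟩
        exact ⟨h', h⟩
      · rintro ⟨h, h'⟩
        exact ⟨h', h, h'.trans h1.le⟩
    rw [he, hg.densityMeasure_Iic, hs, e2]
    simp
  · have e1 : primitive g ⁻¹' Iic a = Iic 1 ∪ Ioi 1 := by
      rw [Iic_union_Ioi]
      ext t
      simpa using (hg.primitive_mem_Icc t).2.trans h1
    have e2 : Iic a ∩ Icc (0:ℝ) 1 = Icc 0 1 := by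
      rw [inter_eq_right]
      intro t ht
      exact ht.2.trans h1
    have e3 : densityMeasure g (Ioi 1) = 0 := by
      rw [densityMeasure, withDensity_apply _ measurableSet_Ioi]
      apply setLIntegral_eq_zero measurableSet_Ioi
      intro u hu
      simp [hg.eq_zero u fun h => by linarith [h.2, mem_Ioi.1 hu]]
    rw [e1, measure_union (by simp) measurableSet_Ioi, e3, hg.densityMeasure_Iic,
      hg.primitive_one, e2]
    simp

lemma preimage_Iic_ae_eq (hg : IsUnitDensity g) (t : ℝ) :
    primitive g ⁻¹' Iic (primitive g t) =ᵐ[densityMeasure g] Iic t := by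
  have := hg.isFiniteMeasure
  symm
  apply ae_eq_of_subset_of_measure_ge
  · intro s hs
    exact hg.monotone_primitive hs
  · rw [← Measure.map_apply hg.continuous_primitive.measurable measurableSet_Iic,
      hg.map_primitive, hg.densityMeasure_Iic, Measure.restrict_apply measurableSet_Iic]
    have e2 : Iic (primitive g t) ∩ Icc (0:ℝ) 1 ⊆ Icc 0 (primitive g t) := by
      rintro s ⟨h, h', -⟩
      exact ⟨h', h⟩
    exact (measure_mono e2).trans (by simp)
  · exact measurableSet_Iic.nullMeasurableSet
  · exact measure_ne_top _ _

variable {F : Type*} [NormedAddCommGroup F] [NormedSpace ℝ F]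

lemma integrable_smul_comp_iff (hg : IsUnitDensity g) {f : ℝ → F} (hf : StronglyMeasurable f) :
    Integrable (fun t => g t • f (primitive g t)) ↔ IntegrableOn f (Icc 0 1) := by
  rw [IntegrableOn, ← hg.map_primitive, integrable_map_measure hf.aestronglyMeasurable
    hg.continuous_primitive.aemeasurable, densityMeasure,
    integrable_withDensity_iff_integrable_smul' hg.measurable.ennreal_ofReal (by simp)]
  simp [ENNReal.toReal_ofReal, hg.nonneg]

/-- Change of variables for a monotone absolutely continuous substitution. -/
lemma integral_smul_comp (hg : IsUnitDensity g) {f : ℝ → F} (hf : StronglyMeasurable f) {t : ℝ}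
    (ht : 0 ≤ t) :
    ∫ τ in (0:ℝ)..t, g τ • f (primitive g τ) = ∫ u in (0:ℝ)..primitive g t, f u := by
  have hp := hg.primitive_mem_Icc t
  have e1 : ∫ u in (0:ℝ)..primitive g t, f u =
      ∫ u in Iic (primitive g t), f u ∂(volume.restrict (Icc (0:ℝ) 1)) := by
    rw [intervalIntegral.integral_of_le hp.1, Measure.restrict_restrict measurableSet_Iic,
      ← integral_Icc_eq_integral_Ioc]
    congr 2
    ext u
    simp only [mem_inter_iff, mem_Iic, mem_Icc]
    constructor
    · rintro ⟨h, h'⟩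
      exact ⟨h', h, h'.trans hp.2⟩
    · rintro ⟨h, h', -⟩
      exact ⟨h', h⟩
  rw [e1, ← hg.map_primitive, setIntegral_map measurableSet_Iic hf.aestronglyMeasurable
    hg.continuous_primitive.aemeasurable, Measure.restrict_congr_set (hg.preimage_Iic_ae_eq t),
    densityMeasure, setIntegral_withDensity_eq_setIntegral_toReal_smul
      hg.measurable.ennreal_ofReal (by simp) _ measurableSet_Iic]
  simp only [ENNReal.toReal_ofReal, hg.nonneg]
  rw [intervalIntegral.integral_of_le ht, ← integral_Icc_eq_integral_Ioc]
  apply setIntegral_eq_of_subset_of_forall_sdiff_eq_zero measurableSet_Iic (fun u hu => hu.2) _ |>.symm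
  rintro u ⟨hu, hu'⟩
  rw [hg.eq_zero u fun h => hu' ⟨h.1, hu⟩, zero_smul]

end IsUnitDensity

namespace IsUnitDensity

lemma stronglyMeasurable_smul_comp {F : Type*} [NormedAddCommGroup F] [NormedSpace ℝ F]
    {g : ℝ → ℝ} (hg : IsUnitDensity g) {f : ℝ → F} (hf : StronglyMeasurable f) :
    StronglyMeasurable fun t => g t • f (primitive g t) :=
  hg.measurable.stronglyMeasurable.smul (hf.comp_measurable hg.continuous_primitive.measurable)

lemma comp {g h : ℝ → ℝ} (hg : IsUnitDensity g) (hh : IsUnitDensity h) :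
    IsUnitDensity fun t => h t • g (primitive h t) where
  measurable := (hh.stronglyMeasurable_smul_comp hg.measurable.stronglyMeasurable).measurable
  nonneg t := smul_nonneg (hh.nonneg t) (hg.nonneg _)
  eq_zero t ht := by simp [hh.eq_zero t ht]
  integrable := (hh.integrable_smul_comp_iff hg.measurable.stronglyMeasurable).2
    hg.integrable.integrableOn
  integral_eq := by
    rw [hh.integral_smul_comp hg.measurable.stronglyMeasurable zero_le_one, hh.primitive_one,
      hg.integral_eq]

lemma primitive_comp {g h : ℝ → ℝ} (hg : IsUnitDensity g) (hh : IsUnitDensity h) {t : ℝ}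
    (ht : 0 ≤ t) :
    primitive (fun t => h t • g (primitive h t)) t = primitive g (primitive h t) :=
  hh.integral_smul_comp hg.measurable.stronglyMeasurable ht

/-- A property that holds almost everywhere on `[0,1]` pulls back along `primitive g`,
except possibly where `g` vanishes. -/
lemma ae_comp_of_ae {g : ℝ → ℝ} (hg : IsUnitDensity g) {p : ℝ → Prop}
    (hp : ∀ᵐ u ∂(volume.restrict (Icc (0:ℝ) 1)), p u) :
    ∀ᵐ t, 0 < g t → p (primitive g t) := by
  rw [← hg.map_primitive] at hp
  have h := ae_of_ae_map hg.continuous_primitive.aemeasurable hp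
  rw [densityMeasure, ae_withDensity_iff hg.measurable.ennreal_ofReal] at h
  filter_upwards [h] with t ht hpos
  exact ht (by simpa using hpos)

lemma ae_of_ae_comp {g : ℝ → ℝ} (hg : IsUnitDensity g) {p : ℝ → Prop}
    (hpm : MeasurableSet {u | p u}) (hp : ∀ᵐ t, 0 < g t → p (primitive g t)) :
    ∀ᵐ u ∂(volume.restrict (Icc (0:ℝ) 1)), p u := by
  rw [← hg.map_primitive, ae_map_iff hg.continuous_primitive.aemeasurable hpm, densityMeasure,
    ae_withDensity_iff hg.measurable.ennreal_ofReal]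
  filter_upwards [hp] with t ht hne
  exact ht (by simpa using hne)

lemma of_isACDerivR {γ g : ℝ → ℝ} (h : IsACDerivR γ g)
    (h0 : ∀ᵐ t ∂(volume.restrict (Icc (0:ℝ) 1)), 0 ≤ g t) (h1 : γ 1 = 1) :
    ∃ g', IsUnitDensity g' ∧ g' =ᵐ[volume.restrict (Icc (0:ℝ) 1)] g ∧
      EqOn γ (primitive g') (Icc 0 1) := by
  obtain ⟨hm, hi, hγ⟩ := h
  have hae : (Icc (0:ℝ) 1).indicator (fun t => max (g t) 0)
      =ᵐ[volume.restrict (Icc (0:ℝ) 1)] g := by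
    filter_upwards [h0, ae_restrict_mem measurableSet_Icc] with t ht ht'
    simp [ht', ht]
  have hmax : Measurable fun t => max (g t) 0 := hm.measurable.max measurable_const
  have heq : EqOn γ (primitive ((Icc (0:ℝ) 1).indicator fun t => max (g t) 0)) (Icc 0 1) := by
    intro t ht
    rw [hγ t ht, primitive]
    apply intervalIntegral.integral_congr_ae_restrict
    rw [uIoc_of_le ht.1]
    refine (ae_restrict_of_ae_restrict_of_subset ?_ hae).mono fun _ h => h.symm
    exact fun u hu => ⟨hu.1.le, hu.2.trans ht.2⟩
  refine ⟨_, ⟨hmax.indicator measurableSet_Icc, ?_, ?_, ?_, ?_⟩, hae, heq⟩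
  · exact fun t => indicator_nonneg (fun _ _ => le_max_right _ _) t
  · exact fun t ht => indicator_of_notMem ht _
  · rw [integrable_indicator_iff measurableSet_Icc]
    refine hi.congr_fun_ae ?_
    filter_upwards [h0] with t ht
    simp [ht]
  · exact (heq (right_mem_Icc.2 zero_le_one)).symm.trans h1

end IsUnitDensity

lemma memGammaBar_iff {γ : ℝ → ℝ} :
    MemGammaBar γ ↔ ∃ g, IsUnitDensity g ∧ EqOn γ (primitive g) (Icc 0 1) := by
  constructor
  · rintro ⟨g, hg, h0, h1⟩
    obtain ⟨g', hg', -, h⟩ := IsUnitDensity.of_isACDerivR hg h0 h1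
    exact ⟨g', hg', h⟩
  · rintro ⟨g, hg, h⟩
    exact ⟨g, ⟨hg.measurable.stronglyMeasurable, hg.integrable.integrableOn, h⟩,
      Eventually.of_forall hg.nonneg,
      (h (right_mem_Icc.2 zero_le_one)).trans hg.primitive_one⟩

lemma memGamma_iff {γ : ℝ → ℝ} :
    MemGamma γ ↔ ∃ g, IsUnitDensity g ∧ (∀ᵐ t ∂(volume.restrict (Icc (0:ℝ) 1)), 0 < g t) ∧
      EqOn γ (primitive g) (Icc 0 1) := by
  constructor
  · rintro ⟨g, hg, h0, h1⟩
    obtain ⟨g', hg', hae, h⟩ := IsUnitDensity.of_isACDerivR hg (h0.mono fun _ h => h.le) h1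
    refine ⟨g', hg', ?_, h⟩
    filter_upwards [h0, hae] with t ht ht'
    rwa [ht']
  · rintro ⟨g, hg, h0, h⟩
    exact ⟨g, ⟨hg.measurable.stronglyMeasurable, hg.integrable.integrableOn, h⟩, h0,
      (h (right_mem_Icc.2 zero_le_one)).trans hg.primitive_one⟩

lemma MemGamma.memGammaBar {γ : ℝ → ℝ} (h : MemGamma γ) : MemGammaBar γ :=
  let ⟨g, hg, h0, h1⟩ := h
  ⟨g, hg, h0.mono fun _ h => h.le, h1⟩

lemma isUnitDensity_indicator_one : IsUnitDensity ((Icc (0:ℝ) 1).indicator 1) where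
  measurable := measurable_one.indicator measurableSet_Icc
  nonneg t := indicator_nonneg (fun _ _ => zero_le_one) t
  eq_zero t ht := indicator_of_notMem ht _
  integrable := by
    rw [integrable_indicator_iff measurableSet_Icc]
    exact integrableOn_const (by simp)
  integral_eq := by
    rw [intervalIntegral.integral_of_le zero_le_one, ← integral_Icc_eq_integral_Ioc,
      setIntegral_indicator measurableSet_Icc]
    simp

lemma primitive_indicator_one {t : ℝ} (ht : t ∈ Icc (0:ℝ) 1) :
    primitive ((Icc (0:ℝ) 1).indicator 1) t = t := by
  rw [primitive, intervalIntegral.integral_of_le ht.1, ← integral_Icc_eq_integral_Ioc,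
    setIntegral_indicator measurableSet_Icc,
    inter_eq_self_of_subset_left (Icc_subset_Icc_right ht.2)]
  simp [ht.1]

lemma memGamma_id : MemGamma id := by
  refine memGamma_iff.2 ⟨_, isUnitDensity_indicator_one, ?_,
    fun t ht => (primitive_indicator_one ht).symm⟩
  filter_upwards [ae_restrict_mem measurableSet_Icc] with t ht
  simp [indicator_of_mem ht]

lemma MemGamma.comp {γ η : ℝ → ℝ} (hγ : MemGamma γ) (hη : MemGamma η) : MemGamma (γ ∘ η) := by
  obtain ⟨g, hg, g0, ge⟩ := memGamma_iff.1 hγ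
  obtain ⟨h, hh, h0, he⟩ := memGamma_iff.1 hη
  refine memGamma_iff.2 ⟨_, hg.comp hh, ?_, ?_⟩
  · filter_upwards [h0, ae_restrict_of_ae (hh.ae_comp_of_ae g0)] with t ht ht'
    exact smul_pos ht (ht' ht)
  · intro t ht
    rw [hg.primitive_comp hh ht.1, Function.comp, he ht, ge (hh.primitive_mem_Icc t)]

/-- A primitive of an almost everywhere positive density agrees on `[0,1]` with an increasing
bijection of `ℝ`. -/
lemma IsUnitDensity.exists_orderIso {g : ℝ → ℝ} (hg : IsUnitDensity g)
    (g0 : ∀ᵐ t ∂(volume.restrict (Icc (0:ℝ) 1)), 0 < g t) :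
    ∃ e : ℝ ≃o ℝ, EqOn e (primitive g) (Icc 0 1) := by
  have hstrict : StrictMonoOn (primitive g) (Icc 0 1) := by
    intro s hs t ht hst
    rw [← sub_pos, hg.primitive_sub]
    rw [intervalIntegral.integral_pos_iff_support_of_nonneg_ae (Eventually.of_forall hg.nonneg)
      (hg.intervalIntegrable _ _)]
    refine ⟨hst, ?_⟩
    have hae : (Function.support g ∩ Ioc s t : Set ℝ) =ᵐ[volume] Ioc s t := by
      rw [ae_restrict_iff' measurableSet_Icc] at g0
      filter_upwards [g0] with u hu
      apply propext
      refine ⟨fun h => h.2, fun h => ⟨(hu ⟨hs.1.trans h.1.le, h.2.trans ht.2⟩).ne', h⟩⟩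
    rw [measure_congr hae]
    simpa using hst
  let G : ℝ → ℝ := fun t => primitive g t + (max (t - 1) 0 + min t 0)
  have hG : StrictMono G := by
    intro s t hst
    have h1 := hg.monotone_primitive hst.le
    have h2 : max (s - 1) 0 ≤ max (t - 1) 0 := max_le_max_right _ (by linarith)
    have h3 : min s 0 ≤ min t 0 := min_le_min_right _ hst.le
    simp only [G]
    rcases lt_or_ge s 0 with h | h
    · have : min s 0 < min t 0 := by
        rw [min_eq_left h.le]
        exact lt_min hst h
      linarith
    rcases lt_or_ge 1 t with h' | h'
    · have : max (s - 1) 0 < max (t - 1) 0 := by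
        rw [max_eq_left (a := t - 1) (by linarith)]
        exact max_lt (by linarith) (by linarith)
      linarith
    have := hstrict ⟨h, hst.le.trans h'⟩ ⟨h.trans hst.le, h'⟩ hst
    linarith
  have hGc : Continuous G := by
    have := hg.continuous_primitive
    fun_prop
  have hsurj : Function.Surjective G := by
    apply hGc.surjective
    · apply tendsto_atTop_mono (f := fun t : ℝ => t - 1) _ (tendsto_atTop_add_const_right _ _ tendsto_id)
      intro t
      have h1 := (hg.primitive_mem_Icc t).1
      simp only [G]
      rcases le_total t 0 with h | h
      · rw [min_eq_left h, max_eq_right (by linarith)]; linarith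
      · rw [min_eq_right h]; linarith [le_max_left (t - 1) 0]
    · apply tendsto_atBot_mono (f := fun t : ℝ => t + 1) _ (tendsto_atBot_add_const_right _ _ tendsto_id)
      intro t
      have h1 := (hg.primitive_mem_Icc t).2
      simp only [G]
      rcases le_total t 1 with h | h
      · rw [max_eq_right (by linarith)]; linarith [min_le_left t 0]
      · rw [max_eq_left (by linarith)]; linarith [min_le_right t 0]
  refine ⟨hG.orderIsoOfSurjective G hsurj, fun t ht => ?_⟩
  simp [G, ht.1, ht.2]

lemma MemGamma.exists_rightInverse {γ : ℝ → ℝ} (hγ : MemGamma γ) :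
    ∃ η, MemGamma η ∧ ∀ u ∈ Icc (0:ℝ) 1, γ (η u) = u := by
  obtain ⟨g, hg, g0, ge⟩ := memGamma_iff.1 hγ
  obtain ⟨e, he⟩ := hg.exists_orderIso g0
  have e0 : e 0 = 0 := (he (left_mem_Icc.2 zero_le_one)).trans IsUnitDensity.primitive_zero
  have e1 : e 1 = 1 := (he (right_mem_Icc.2 zero_le_one)).trans hg.primitive_one
  have esymm : MapsTo e.symm (Icc 0 1) (Icc 0 1) := by
    intro u hu
    constructor
    · rw [e.le_symm_apply, e0]; exact hu.1
    · rw [e.symm_apply_le, e1]; exact hu.2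
  let h : ℝ → ℝ := (Icc (0:ℝ) 1).indicator fun u => (g (e.symm u))⁻¹
  have hm : Measurable h :=
    (hg.measurable.comp e.symm.monotone.measurable).inv.indicator measurableSet_Icc
  have key : ∀ t ∈ Icc (0:ℝ) 1, h (primitive g t) = (g t)⁻¹ := by
    intro t ht
    simp only [h]
    rw [indicator_of_mem (hg.primitive_mem_Icc t), ← he ht, e.symm_apply_apply]
  have key' : (fun t => g t • h (primitive g t)) =ᵐ[volume] (Icc (0:ℝ) 1).indicator 1 := by
    rw [ae_restrict_iff' measurableSet_Icc] at g0
    filter_upwards [g0] with t ht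
    by_cases ht' : t ∈ Icc (0:ℝ) 1
    · rw [key t ht', indicator_of_mem ht', smul_eq_mul, mul_inv_cancel₀ (ht ht').ne']
      rfl
    · rw [indicator_of_notMem ht', hg.eq_zero t ht', zero_smul]
  have hint : IntegrableOn h (Icc 0 1) := by
    rw [← hg.integrable_smul_comp_iff hm.stronglyMeasurable]
    exact isUnitDensity_indicator_one.integrable.congr key'.symm
  have hprim : ∀ t ∈ Icc (0:ℝ) 1, primitive h (primitive g t) = t := by
    intro t ht
    rw [primitive, ← hg.integral_smul_comp hm.stronglyMeasurable ht.1]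
    exact (intervalIntegral.integral_congr_ae (key'.mono fun _ h _ => h)).trans
      (primitive_indicator_one ht)
  have hprim' : ∀ u ∈ Icc (0:ℝ) 1, primitive h u = e.symm u := by
    intro u hu
    rw [← hprim _ (esymm hu), ← he (esymm hu), e.apply_symm_apply]
  have hd : IsUnitDensity h := by
    refine ⟨hm, ?_, fun t ht => indicator_of_notMem ht _, ?_, ?_⟩
    · exact fun t => indicator_nonneg (fun _ _ => inv_nonneg.2 (hg.nonneg _)) t
    · rw [← integrable_indicator_iff measurableSet_Icc] at hint
      simpa only [h, indicator_indicator, inter_self] using hint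
    · have := hprim' 1 (right_mem_Icc.2 zero_le_one)
      rwa [e.symm_apply_eq.2 e1.symm] at this
  refine ⟨_, memGamma_iff.2 ⟨h, hd, ?_, fun _ _ => rfl⟩, ?_⟩
  · refine hg.ae_of_ae_comp (measurableSet_lt measurable_const hm) ?_
    refine Eventually.of_forall fun t ht => ?_
    have ht' : t ∈ Icc (0:ℝ) 1 := by
      by_contra h
      exact ht.ne' (hg.eq_zero t h)
    rw [key t ht']
    exact inv_pos.2 ht
  · intro u hu
    rw [hprim' u hu, ge (esymm hu), ← he (esymm hu), e.apply_symm_apply]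

section Curves

variable {d : ℕ}

lemma IsACDeriv.congr {x y f : ℝ → E d} (h : IsACDeriv x f) (hxy : EqOn y x (Icc 0 1)) :
    IsACDeriv y f :=
  ⟨h.1, h.2.1, fun t ht => (hxy ht).trans (h.2.2 t ht)⟩

lemma IsACDeriv.intervalIntegrable {x f : ℝ → E d} (h : IsACDeriv x f) {s t : ℝ}
    (hs : s ∈ Icc (0:ℝ) 1) (ht : t ∈ Icc (0:ℝ) 1) : IntervalIntegrable f volume s t := by
  refine (h.2.1.mono_set ?_).intervalIntegrable
  exact uIcc_subset_Icc hs ht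

lemma IsACDeriv.sub {x y f g : ℝ → E d} (hx : IsACDeriv x f) (hy : IsACDeriv y g) :
    IsACDeriv (x - y) (f - g) := by
  refine ⟨hx.1.sub hy.1, hx.2.1.sub hy.2.1, fun t ht => ?_⟩
  have h0 : (0:ℝ) ∈ Icc (0:ℝ) 1 := left_mem_Icc.2 zero_le_one
  rw [Pi.sub_apply, hx.2.2 t ht, hy.2.2 t ht, ← intervalIntegral.integral_sub
    (hx.intervalIntegrable h0 ht) (hy.intervalIntegrable h0 ht)]
  rfl

lemma IsACDeriv.comp {c f : ℝ → E d} (hc : IsACDeriv c f) {g : ℝ → ℝ} (hg : IsUnitDensity g) :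
    IsACDeriv (c ∘ primitive g) fun t => g t • f (primitive g t) := by
  refine ⟨hg.stronglyMeasurable_smul_comp hc.1, ?_, fun t ht => ?_⟩
  · exact ((hg.integrable_smul_comp_iff hc.1).2 hc.2.1).integrableOn
  · rw [hg.integral_smul_comp hc.1 ht.1]
    exact hc.2.2 _ (hg.primitive_mem_Icc t)

lemma IsACDeriv.ae_eq {x f g : ℝ → E d} (hf : IsACDeriv x f) (hg : IsACDeriv x g) :
    f =ᵐ[volume.restrict (Icc (0:ℝ) 1)] g := by
  have h0 : (0:ℝ) ∈ Icc (0:ℝ) 1 := left_mem_Icc.2 zero_le_one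
  have h1 : (1:ℝ) ∈ Icc (0:ℝ) 1 := right_mem_Icc.2 zero_le_one
  have hf' := (hf.intervalIntegrable h0 h1).ae_hasDerivAt_integral
  have hg' := (hg.intervalIntegrable h0 h1).ae_hasDerivAt_integral
  rw [EventuallyEq, ← restrict_Ioo_eq_restrict_Icc, ae_restrict_iff' measurableSet_Ioo]
  filter_upwards [hf', hg'] with t hft hgt ht
  have htI : t ∈ uIcc (0:ℝ) 1 := by
    rw [uIcc_of_le zero_le_one]
    exact Ioo_subset_Icc_self ht
  refine (hft htI 0 left_mem_uIcc).unique ((hgt htI 0 left_mem_uIcc).congr_of_eventuallyEq ?_)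
  filter_upwards [Ioo_mem_nhds ht.1 ht.2] with s hs
  rw [← hf.2.2 s (Ioo_subset_Icc_self hs), ← hg.2.2 s (Ioo_subset_Icc_self hs)]

lemma IsACDeriv.integral_norm_eq {x f g : ℝ → E d} (hf : IsACDeriv x f) (hg : IsACDeriv x g)
    {t : ℝ} (ht : t ∈ Icc (0:ℝ) 1) :
    ∫ τ in (0:ℝ)..t, ‖f τ‖ = ∫ τ in (0:ℝ)..t, ‖g τ‖ := by
  apply intervalIntegral.integral_congr_ae_restrict
  rw [uIoc_of_le ht.1]
  refine (ae_restrict_of_ae_restrict_of_subset ?_ (hf.ae_eq hg)).mono fun τ h => by simp [h]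
  exact fun u hu => ⟨hu.1.le, hu.2.trans ht.2⟩

lemma ACnorm_eq {x f : ℝ → E d} (h : IsACDeriv x f) :
    ACnorm x = ∫ t in (0:ℝ)..1, ‖f t‖ := by
  have hex : ∃ f, IsACDeriv x f := ⟨f, h⟩
  rw [ACnorm, dif_pos hex]
  exact hex.choose_spec.integral_norm_eq h (right_mem_Icc.2 zero_le_one)

lemma ACnorm_congr {x y : ℝ → E d} (hx : ∃ f, IsACDeriv x f) (hxy : EqOn y x (Icc 0 1)) :
    ACnorm y = ACnorm x := by
  obtain ⟨f, hf⟩ := hx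
  rw [ACnorm_eq hf, ACnorm_eq (hf.congr hxy)]

lemma ACnorm_sub_le {x y z : ℝ → E d} (hx : ∃ f, IsACDeriv x f) (hy : ∃ f, IsACDeriv y f)
    (hz : ∃ f, IsACDeriv z f) : ACnorm (x - z) ≤ ACnorm (x - y) + ACnorm (y - z) := by
  obtain ⟨f, hf⟩ := hx
  obtain ⟨g, hg⟩ := hy
  obtain ⟨k, hk⟩ := hz
  have h0 : (0:ℝ) ∈ Icc (0:ℝ) 1 := left_mem_Icc.2 zero_le_one
  have h1 : (1:ℝ) ∈ Icc (0:ℝ) 1 := right_mem_Icc.2 zero_le_one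
  have hfg := ((hf.sub hg).intervalIntegrable h0 h1).norm
  have hgk := ((hg.sub hk).intervalIntegrable h0 h1).norm
  rw [ACnorm_eq (hf.sub hk), ACnorm_eq (hf.sub hg), ACnorm_eq (hg.sub hk),
    ← intervalIntegral.integral_add hfg hgk]
  refine intervalIntegral.integral_mono_on zero_le_one
    ((hf.sub hk).intervalIntegrable h0 h1).norm (hfg.add hgk) fun t _ => ?_
  exact norm_sub_le_norm_sub_add_norm_sub _ _ _

lemma ACnorm_sub_comm {x y : ℝ → E d} (hx : ∃ f, IsACDeriv x f) (hy : ∃ f, IsACDeriv y f) :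
    ACnorm (x - y) = ACnorm (y - x) := by
  obtain ⟨f, hf⟩ := hx
  obtain ⟨g, hg⟩ := hy
  rw [ACnorm_eq (hf.sub hg), ACnorm_eq (hg.sub hf)]
  simp only [Pi.sub_apply, norm_sub_rev]

lemma integral_norm_smul_comp {f : ℝ → E d} (hf : StronglyMeasurable f) {g : ℝ → ℝ}
    (hg : IsUnitDensity g) {t : ℝ} (ht : 0 ≤ t) :
    ∫ τ in (0:ℝ)..t, ‖g τ • f (primitive g τ)‖ = ∫ u in (0:ℝ)..primitive g t, ‖f u‖ := by
  rw [← hg.integral_smul_comp hf.norm ht]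
  simp only [norm_smul, Real.norm_of_nonneg (hg.nonneg _), smul_eq_mul]

lemma ACnorm_comp {c : ℝ → E d} (hc : ∃ f, IsACDeriv c f) {g : ℝ → ℝ} (hg : IsUnitDensity g) :
    ACnorm (c ∘ primitive g) = ACnorm c := by
  obtain ⟨f, hf⟩ := hc
  rw [ACnorm_eq (hf.comp hg), ACnorm_eq hf, integral_norm_smul_comp hf.1 hg zero_le_one,
    hg.primitive_one]

lemma norm_sub_le_integral {c f : ℝ → E d} (hc : IsACDeriv c f) {s t : ℝ}
    (hs : s ∈ Icc (0:ℝ) 1) (ht : t ∈ Icc (0:ℝ) 1) :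
    ‖c t - c s‖ ≤ |(∫ τ in (0:ℝ)..t, ‖f τ‖) - ∫ τ in (0:ℝ)..s, ‖f τ‖| := by
  have h0 : (0:ℝ) ∈ Icc (0:ℝ) 1 := left_mem_Icc.2 zero_le_one
  rw [hc.2.2 s hs, hc.2.2 t ht, intervalIntegral.integral_interval_sub_left
    (hc.intervalIntegrable h0 ht) (hc.intervalIntegrable h0 hs),
    intervalIntegral.integral_interval_sub_left
    (hc.intervalIntegrable h0 ht).norm (hc.intervalIntegrable h0 hs).norm]
  exact intervalIntegral.norm_integral_le_abs_integral_norm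

lemma IsUnitDensity.convex_combo {g h : ℝ → ℝ} (hg : IsUnitDensity g) (hh : IsUnitDensity h)
    {δ : ℝ} (h0 : 0 ≤ δ) (h1 : δ ≤ 1) : IsUnitDensity fun t => (1 - δ) * g t + δ * h t where
  measurable := (hg.measurable.const_mul _).add (hh.measurable.const_mul _)
  nonneg t := add_nonneg (mul_nonneg (sub_nonneg.2 h1) (hg.nonneg t)) (mul_nonneg h0 (hh.nonneg t))
  eq_zero t ht := by simp [hg.eq_zero t ht, hh.eq_zero t ht]
  integrable := (hg.integrable.const_mul _).add (hh.integrable.const_mul _)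
  integral_eq := by
    rw [intervalIntegral.integral_add ((hg.intervalIntegrable _ _).const_mul _)
      ((hh.intervalIntegrable _ _).const_mul _), intervalIntegral.integral_const_mul,
      intervalIntegral.integral_const_mul, hg.integral_eq, hh.integral_eq]
    ring

lemma IsUnitDensity.primitive_convex_combo {g h : ℝ → ℝ} (hg : IsUnitDensity g)
    (hh : IsUnitDensity h) (δ t : ℝ) :
    primitive (fun t => (1 - δ) * g t + δ * h t) t
      = (1 - δ) * primitive g t + δ * primitive h t := by
  simp only [primitive]
  rw [intervalIntegral.integral_add ((hg.intervalIntegrable _ _).const_mul _)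
      ((hh.intervalIntegrable _ _).const_mul _), intervalIntegral.integral_const_mul,
      intervalIntegral.integral_const_mul]

lemma tendsto_integral_norm_sub_convex_combo {φ : ℝ → E d} (hφ : Continuous φ) {M : ℝ}
    (hM : ∀ u, ‖φ u‖ ≤ M) {g i : ℝ → ℝ} (hg : IsUnitDensity g) (hi : IsUnitDensity i)
    {δ : ℕ → ℝ} (δ0 : ∀ n, 0 ≤ δ n) (δ1 : ∀ n, δ n ≤ 1) (hδ : Tendsto δ atTop (nhds 0)) :
    Tendsto (fun n => ∫ t in (0:ℝ)..1, ‖g t • φ (primitive g t) -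
      ((1 - δ n) * g t + δ n * i t) •
        φ (primitive (fun t => (1 - δ n) * g t + δ n * i t) t)‖) atTop (nhds 0) := by
  have hlim := intervalIntegral.tendsto_integral_filter_of_dominated_convergence
    (μ := volume) (a := 0) (b := 1) (l := atTop) (f := fun _ => (0:ℝ))
    (F := fun n t => ‖g t • φ (primitive g t) - ((1 - δ n) * g t + δ n * i t) •
        φ (primitive (fun t => (1 - δ n) * g t + δ n * i t) t)‖)
    (fun t => g t * M + (g t + i t) * M) ?_ ?_ ?_ ?_
  · simpa using hlim
  · refine Eventually.of_forall fun n => ?_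
    exact ((hg.stronglyMeasurable_smul_comp hφ.stronglyMeasurable).sub
      ((hg.convex_combo hi (δ0 n) (δ1 n)).stronglyMeasurable_smul_comp
        hφ.stronglyMeasurable)).norm.aestronglyMeasurable
  · refine Eventually.of_forall fun n => Eventually.of_forall fun t _ => ?_
    have hc := (hg.convex_combo hi (δ0 n) (δ1 n)).nonneg t
    have hle : (1 - δ n) * g t + δ n * i t ≤ g t + i t := by
      nlinarith [mul_nonneg (δ0 n) (hg.nonneg t), mul_nonneg (sub_nonneg.2 (δ1 n)) (hi.nonneg t)]
    rw [norm_norm]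
    refine (norm_sub_le _ _).trans (add_le_add ?_ ?_)
    · rw [norm_smul, Real.norm_of_nonneg (hg.nonneg t)]
      exact mul_le_mul_of_nonneg_left (hM _) (hg.nonneg t)
    · rw [norm_smul, Real.norm_of_nonneg hc]
      exact mul_le_mul hle (hM _) (norm_nonneg _) (hc.trans hle)
  · exact ((hg.intervalIntegrable _ _).mul_const _).add
      (((hg.intervalIntegrable _ _).add (hi.intervalIntegrable _ _)).mul_const _)
  · refine Eventually.of_forall fun t _ => ?_
    simp only [hg.primitive_convex_combo hi]
    have hden : Tendsto (fun n => (1 - δ n) * g t + δ n * i t) atTop (nhds (g t)) := by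
      simpa using ((hδ.const_sub 1).mul_const (g t)).add (hδ.mul_const (i t))
    have hpr : Tendsto (fun n => (1 - δ n) * primitive g t + δ n * primitive i t) atTop
        (nhds (primitive g t)) := by
      simpa using ((hδ.const_sub 1).mul_const (primitive g t)).add (hδ.mul_const (primitive i t))
    simpa using ((hden.smul ((hφ.tendsto _).comp hpr)).const_sub (g t • φ (primitive g t))).norm

/-- Curves can be reparametrised by elements of `Γ` up to arbitrarily small error. -/
lemma exists_memGamma_approx {a f : ℝ → E d} (ha : IsACDeriv a f) {g : ℝ → ℝ}
    (hg : IsUnitDensity g) {ε : ℝ} (hε : 0 < ε) :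
    ∃ h, IsUnitDensity h ∧ MemGamma (primitive h) ∧
      ACnorm (a ∘ primitive g - a ∘ primitive h) < ε := by
  obtain ⟨φ, hφc, hφε, hφ, hφi⟩ :=
    ha.2.1.exists_hasCompactSupport_integral_sub_le (show 0 < ε / 4 by linarith)
  obtain ⟨M, hM⟩ := hφ.bounded_above_of_compact_support hφc
  let Φ : ℝ → E d := fun t => ∫ τ in (0:ℝ)..t, φ τ
  have hΦ : IsACDeriv Φ φ := ⟨hφ.stronglyMeasurable, hφi, fun _ _ => rfl⟩
  have haΦ : ACnorm (a - Φ) ≤ ε / 4 := by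
    rw [ACnorm_eq (ha.sub hΦ), intervalIntegral.integral_of_le zero_le_one,
      ← integral_Icc_eq_integral_Ioc]
    exact hφε
  have hi := isUnitDensity_indicator_one
  have hδ := tendsto_one_div_add_atTop_nhds_zero_nat (𝕜 := ℝ)
  have δ0 : ∀ n : ℕ, (0:ℝ) < 1 / ((n:ℝ) + 1) := fun n => by positivity
  have δ1 : ∀ n : ℕ, 1 / ((n:ℝ) + 1) ≤ 1 := fun n => by
    rw [div_le_one (by positivity)]
    linarith [n.cast_nonneg (α := ℝ)]
  obtain ⟨n, hn⟩ := ((tendsto_integral_norm_sub_convex_combo hφ hM hg hi (fun n => (δ0 n).le) δ1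
    hδ).eventually (gt_mem_nhds (show 0 < ε / 4 by linarith))).exists
  have hh := hg.convex_combo hi (δ0 n).le (δ1 n)
  refine ⟨_, hh, memGamma_iff.2 ⟨_, hh, ?_, fun _ _ => rfl⟩, ?_⟩
  · filter_upwards [ae_restrict_mem measurableSet_Icc] with t ht
    rw [indicator_of_mem ht]
    have := mul_nonneg (sub_nonneg.2 (δ1 n)) (hg.nonneg t)
    simp only [Pi.one_apply, mul_one]
    linarith [δ0 n]
  · set h := fun t => (1 - 1 / ((n:ℝ) + 1)) * g t + 1 / ((n:ℝ) + 1) * (Icc (0:ℝ) 1).indicator 1 t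
    have hag : ∃ f, IsACDeriv (a ∘ primitive g) f := ⟨_, ha.comp hg⟩
    have hah : ∃ f, IsACDeriv (a ∘ primitive h) f := ⟨_, ha.comp hh⟩
    have hΦg : ∃ f, IsACDeriv (Φ ∘ primitive g) f := ⟨_, hΦ.comp hg⟩
    have hΦh : ∃ f, IsACDeriv (Φ ∘ primitive h) f := ⟨_, hΦ.comp hh⟩
    have e1 : ACnorm (a ∘ primitive g - Φ ∘ primitive g) ≤ ε / 4 :=
      (ACnorm_comp ⟨_, ha.sub hΦ⟩ hg).trans_le haΦ
    have e2 : ACnorm (a ∘ primitive h - Φ ∘ primitive h) ≤ ε / 4 :=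
      (ACnorm_comp ⟨_, ha.sub hΦ⟩ hh).trans_le haΦ
    have e3 : ACnorm (Φ ∘ primitive g - Φ ∘ primitive h) < ε / 4 := by
      rw [ACnorm_eq ((hΦ.comp hg).sub (hΦ.comp hh))]
      exact hn
    rw [ACnorm_sub_comm hah hΦh] at e2
    linarith [ACnorm_sub_le hag hΦg hah, ACnorm_sub_le hΦg hΦh hah]

lemma lipschitz_exists_isACDeriv {a : ℝ → E d} {K : ℝ≥0} (ha : LipschitzOnWith K a (Icc 0 1))
    (h0 : a 0 = 0) : ∃ f, IsACDeriv a f := by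
  have hA : LipschitzWith K (IccExtend zero_le_one ((Icc (0:ℝ) 1).domRestrict a)) := by
    have h := ha.to_restrict.comp (LipschitzWith.projIcc (zero_le_one (α := ℝ)))
    rw [mul_one] at h
    exact h
  set A := IccExtend (zero_le_one (α := ℝ)) ((Icc (0:ℝ) 1).domRestrict a) with hAdef
  have hAeq : EqOn A a (Icc 0 1) := fun t ht => by
    rw [hAdef, IccExtend_of_mem _ _ ht]; rfl
  have hm : StronglyMeasurable (deriv A) := stronglyMeasurable_deriv A
  have hint : ∀ s t : ℝ, IntervalIntegrable (deriv A) volume s t := fun s t =>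
    (intervalIntegrable_const (c := (K : ℝ))).mono_fun hm.aestronglyMeasurable
      (Eventually.of_forall fun u => by simpa using norm_deriv_le_of_lipschitz hA)
  have hnorm : ∀ u, ‖deriv A u‖ ≤ K := fun u => norm_deriv_le_of_lipschitz hA
  have hlip : LipschitzWith K fun t => ∫ τ in (0:ℝ)..t, deriv A τ := by
    apply LipschitzWith.of_dist_le_mul
    intro s t
    rw [dist_eq_norm, intervalIntegral.integral_interval_sub_left (hint _ _) (hint _ _),
      Real.dist_eq]
    exact intervalIntegral.norm_integral_le_of_norm_le_const fun u _ => hnorm u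
  have hac : AbsolutelyContinuousOnInterval (fun t => A t - ∫ τ in (0:ℝ)..t, deriv A τ) 0 1 :=
    ((hA.sub hlip).lipschitzOnWith).absolutelyContinuousOnInterval
  obtain ⟨C, hC⟩ := hac.const_of_ae_hasDerivAt_zero (by
    filter_upwards [hA.ae_differentiableAt_real, (hint 0 1).ae_hasDerivAt_integral] with t h1 h2 ht
    have h := h1.hasDerivAt.sub (h2 ht 0 left_mem_uIcc)
    rw [sub_self] at h
    exact h)
  rw [uIcc_of_le zero_le_one] at hC
  have hz : (0:ℝ) ∈ Icc (0:ℝ) 1 := left_mem_Icc.2 zero_le_one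
  have hC0 : C = 0 := by
    rw [← hC 0 hz, hAeq hz, h0]
    simp
  refine ⟨deriv A, hm, ?_, fun t ht => ?_⟩
  · rw [← uIcc_of_le (zero_le_one (α := ℝ)), ← intervalIntegrable_iff']
    exact hint 0 1
  · rw [← hAeq ht]
    exact sub_eq_zero.1 ((hC t ht).trans hC0)

end Curves

section Equivalence

variable {d : ℕ}

/-- Curves `b` and `c` with derivatives `f` and `g` have the same length, and agree at any two
times up to which they have covered the same length. -/
def SameArcLengthCurve (b f c g : ℝ → E d) : Prop :=
  (∫ τ in (0:ℝ)..1, ‖f τ‖) = ∫ τ in (0:ℝ)..1, ‖g τ‖ ∧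
    ∀ s ∈ Icc (0:ℝ) 1, ∀ t ∈ Icc (0:ℝ) 1,
      (∫ τ in (0:ℝ)..s, ‖f τ‖) = ∫ τ in (0:ℝ)..t, ‖g τ‖ → b s = c t

lemma SameArcLengthCurve.symm {b f c g : ℝ → E d} (h : SameArcLengthCurve b f c g) :
    SameArcLengthCurve c g b f :=
  ⟨h.1.symm, fun s hs t ht hst => (h.2 t ht s hs hst.symm).symm⟩

lemma IsACDeriv.arcLength_mem {c f : ℝ → E d} (hc : IsACDeriv c f) {t : ℝ}
    (ht : t ∈ Icc (0:ℝ) 1) :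
    ∫ τ in (0:ℝ)..t, ‖f τ‖ ∈ Icc 0 (∫ τ in (0:ℝ)..1, ‖f τ‖) := by
  have h0 : (0:ℝ) ∈ Icc (0:ℝ) 1 := left_mem_Icc.2 zero_le_one
  have h1 : (1:ℝ) ∈ Icc (0:ℝ) 1 := right_mem_Icc.2 zero_le_one
  refine ⟨intervalIntegral.integral_nonneg ht.1 fun _ _ => norm_nonneg _, ?_⟩
  rw [← sub_nonneg, intervalIntegral.integral_interval_sub_left
    (hc.intervalIntegrable h0 h1).norm (hc.intervalIntegrable h0 ht).norm]
  exact intervalIntegral.integral_nonneg ht.2 fun _ _ => norm_nonneg _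

lemma IsACDeriv.exists_arcLength_eq {c f : ℝ → E d} (hc : IsACDeriv c f) {u : ℝ}
    (hu : u ∈ Icc 0 (∫ τ in (0:ℝ)..1, ‖f τ‖)) :
    ∃ t ∈ Icc (0:ℝ) 1, ∫ τ in (0:ℝ)..t, ‖f τ‖ = u := by
  have hcont : ContinuousOn (fun t => ∫ τ in (0:ℝ)..t, ‖f τ‖) (Icc 0 1) := by
    have := intervalIntegral.continuousOn_primitive_interval (μ := volume) (a := (0:ℝ)) (b := 1)
      (f := fun τ => ‖f τ‖) (by rw [uIcc_of_le zero_le_one]; exact hc.2.1.norm)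
    rwa [uIcc_of_le zero_le_one] at this
  have := intermediate_value_Icc zero_le_one hcont
  obtain ⟨t, ht, h⟩ := this (by simpa using hu)
  exact ⟨t, ht, h⟩

lemma SameArcLengthCurve.trans {b f c g e k : ℝ → E d} (hb : IsACDeriv b f) (hc : IsACDeriv c g)
    (h : SameArcLengthCurve b f c g) (h' : SameArcLengthCurve c g e k) :
    SameArcLengthCurve b f e k := by
  refine ⟨h.1.trans h'.1, fun s hs t ht hst => ?_⟩
  obtain ⟨r, hr, hr'⟩ := hc.exists_arcLength_eq (h.1 ▸ hb.arcLength_mem hs)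
  exact (h.2 s hs r hr hr'.symm).trans (h'.2 r hr t ht (hr'.trans hst))

lemma arcLength_of_eqOn_comp {a f : ℝ → E d} (ha : IsACDeriv a f) {b k : ℝ → E d}
    (hb : IsACDeriv b k) {g : ℝ → ℝ} (hg : IsUnitDensity g)
    (h : EqOn b (a ∘ primitive g) (Icc 0 1)) {t : ℝ} (ht : t ∈ Icc (0:ℝ) 1) :
    ∫ τ in (0:ℝ)..t, ‖k τ‖ = ∫ τ in (0:ℝ)..primitive g t, ‖f τ‖ := by
  rw [hb.integral_norm_eq ((ha.comp hg).congr h) ht, integral_norm_smul_comp ha.1 hg ht.1]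

lemma exists_density_of_mem_orbitBar {a b : ℝ → E d} (h : b ∈ OrbitBar a) :
    ∃ g, IsUnitDensity g ∧ EqOn b (a ∘ primitive g) (Icc 0 1) := by
  obtain ⟨γ, hγ, hb⟩ := h
  obtain ⟨g, hg, he⟩ := memGammaBar_iff.1 hγ
  exact ⟨g, hg, fun t ht => by rw [hb t ht, he ht]; rfl⟩

lemma sameArcLengthCurve_of_mem_orbitBar {a b c f g : ℝ → E d} (ha : ∃ fa, IsACDeriv a fa)
    (hb : IsACDeriv b f) (hc : IsACDeriv c g) (hba : b ∈ OrbitBar a) (hca : c ∈ OrbitBar a) :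
    SameArcLengthCurve b f c g := by
  obtain ⟨fa, ha⟩ := ha
  obtain ⟨β, hβ, eβ⟩ := exists_density_of_mem_orbitBar hba
  obtain ⟨γ, hγ, eγ⟩ := exists_density_of_mem_orbitBar hca
  have h1 : (1:ℝ) ∈ Icc (0:ℝ) 1 := right_mem_Icc.2 zero_le_one
  refine ⟨?_, fun s hs t ht hst => ?_⟩
  · rw [arcLength_of_eqOn_comp ha hb hβ eβ h1, arcLength_of_eqOn_comp ha hc hγ eγ h1,
      hβ.primitive_one, hγ.primitive_one]
  · rw [arcLength_of_eqOn_comp ha hb hβ eβ hs, arcLength_of_eqOn_comp ha hc hγ eγ ht] at hst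
    have := norm_sub_le_integral ha (hγ.primitive_mem_Icc t) (hβ.primitive_mem_Icc s)
    rw [hst, sub_self, abs_zero] at this
    rw [eβ hs, eγ ht]
    exact sub_eq_zero.1 (norm_le_zero_iff.1 this)

lemma IsACDeriv.memGammaBar_arcLength {c f : ℝ → E d} (hc : IsACDeriv c f)
    (hL : 0 < ∫ τ in (0:ℝ)..1, ‖f τ‖) :
    MemGammaBar fun t => (∫ τ in (0:ℝ)..1, ‖f τ‖)⁻¹ * ∫ τ in (0:ℝ)..t, ‖f τ‖ := by
  refine ⟨fun t => (∫ τ in (0:ℝ)..1, ‖f τ‖)⁻¹ * ‖f t‖, ⟨hc.1.norm.const_mul _,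
    hc.2.1.norm.const_mul _, fun t _ => ?_⟩, Eventually.of_forall fun t => ?_, ?_⟩
  · rw [intervalIntegral.integral_const_mul]
  · exact mul_nonneg (inv_nonneg.2 hL.le) (norm_nonneg _)
  · exact inv_mul_cancel₀ hL.ne'

lemma IsACDeriv.apply_zero {c f : ℝ → E d} (hc : IsACDeriv c f) : c 0 = 0 := by
  rw [hc.2.2 0 (left_mem_Icc.2 zero_le_one)]
  simp

lemma SameArcLengthCurve.exists_orbitBar {b c f g : ℝ → E d} (hb : IsACDeriv b f)
    (hc : IsACDeriv c g) (h : SameArcLengthCurve b f c g) :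
    ∃ a : ℝ → E d, (∃ fa, IsACDeriv a fa) ∧ b ∈ OrbitBar a ∧ c ∈ OrbitBar a := by
  have h0 : (0:ℝ) ∈ Icc (0:ℝ) 1 := left_mem_Icc.2 zero_le_one
  have h1 : (1:ℝ) ∈ Icc (0:ℝ) 1 := right_mem_Icc.2 zero_le_one
  rcases (hc.arcLength_mem h1).1.eq_or_lt with hL | hL
  · refine ⟨c, ⟨g, hc⟩, ⟨id, memGamma_id.memGammaBar, fun t ht => h.2 t ht t ht ?_⟩,
      ⟨id, memGamma_id.memGammaBar, fun t _ => rfl⟩⟩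
    have h2 := hc.arcLength_mem ht
    have h3 := hb.arcLength_mem ht
    rw [← hL] at h2
    rw [h.1, ← hL] at h3
    linarith [h2.1, h2.2, h3.1, h3.2]
  set L := ∫ τ in (0:ℝ)..1, ‖g τ‖ with hLdef
  have hex : ∀ u ∈ Icc (0:ℝ) 1, ∃ t ∈ Icc (0:ℝ) 1, ∫ τ in (0:ℝ)..t, ‖g τ‖ = L * u := by
    intro u hu
    apply hc.exists_arcLength_eq
    exact ⟨mul_nonneg hL.le hu.1, mul_le_of_le_one_right hL.le hu.2⟩
  choose! s hs hsL using hex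
  have hmem : ∀ x ∈ Icc 0 L, L⁻¹ * x ∈ Icc (0:ℝ) 1 := fun x hx =>
    ⟨mul_nonneg (inv_nonneg.2 hL.le) hx.1, by
      rw [inv_mul_le_iff₀ hL, mul_one]; exact hx.2⟩
  refine ⟨c ∘ s, ?_, ⟨_, hb.memGammaBar_arcLength (h.1 ▸ hL), fun t ht => ?_⟩,
    ⟨_, hc.memGammaBar_arcLength hL, fun t ht => ?_⟩⟩
  · apply lipschitz_exists_isACDeriv (K := L.toNNReal)
    · apply LipschitzOnWith.of_dist_le_mul
      intro u hu v hv
      rw [dist_eq_norm, Real.dist_eq, Real.coe_toNNReal _ hL.le]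
      refine (norm_sub_le_integral hc (hs v hv) (hs u hu)).trans_eq ?_
      rw [hsL u hu, hsL v hv, ← mul_sub, abs_mul, abs_of_pos hL]
    · have := norm_sub_le_integral hc h0 (hs 0 h0)
      rw [hsL 0 h0, hc.apply_zero] at this
      simpa using this
  · have hm := h.1 ▸ hb.arcLength_mem ht
    refine h.2 t ht _ (hs _ ?_) ?_
    · rw [h.1]; exact hmem _ hm
    · rw [h.1, hsL _ (hmem _ hm), mul_inv_cancel_left₀ hL.ne']
  · have hm := hc.arcLength_mem ht
    have := norm_sub_le_integral hc (hs _ (hmem _ hm)) ht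
    rw [hsL _ (hmem _ hm), mul_inv_cancel_left₀ hL.ne', sub_self, abs_zero] at this
    exact sub_eq_zero.1 (norm_le_zero_iff.1 this)

lemma norm_sub_le_ACnorm {x y : ℝ → E d} (hx : ∃ f, IsACDeriv x f) (hy : ∃ f, IsACDeriv y f)
    {t : ℝ} (ht : t ∈ Icc (0:ℝ) 1) : ‖x t - y t‖ ≤ ACnorm (x - y) := by
  obtain ⟨f, hf⟩ := hx
  obtain ⟨g, hg⟩ := hy
  have h := hf.sub hg
  rw [ACnorm_eq h]
  refine le_trans ?_ (h.arcLength_mem ht).2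
  have h2 := norm_sub_le_integral h (left_mem_Icc.2 zero_le_one) ht
  rw [h.apply_zero, sub_zero, intervalIntegral.integral_same, sub_zero,
    abs_of_nonneg (h.arcLength_mem ht).1] at h2
  exact h2

lemma abs_arcLength_sub_le_ACnorm {x y f g : ℝ → E d} (hx : IsACDeriv x f) (hy : IsACDeriv y g)
    {t : ℝ} (ht : t ∈ Icc (0:ℝ) 1) :
    |(∫ τ in (0:ℝ)..t, ‖f τ‖) - ∫ τ in (0:ℝ)..t, ‖g τ‖| ≤ ACnorm (x - y) := by
  have h0 : (0:ℝ) ∈ Icc (0:ℝ) 1 := left_mem_Icc.2 zero_le_one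
  have h := hx.sub hy
  rw [ACnorm_eq h]
  refine le_trans ?_ (h.arcLength_mem ht).2
  have hf := (hx.intervalIntegrable h0 ht).norm
  have hg := (hy.intervalIntegrable h0 ht).norm
  rw [← intervalIntegral.integral_sub hf hg]
  refine (intervalIntegral.abs_integral_le_integral_abs ht.1).trans ?_
  refine intervalIntegral.integral_mono_on ht.1 (hf.sub hg).abs
    (h.intervalIntegrable h0 ht).norm fun τ _ => ?_
  exact abs_norm_sub_norm_le _ _

lemma exists_isACDeriv_of_mem_orbitBar {a b : ℝ → E d} (ha : ∃ f, IsACDeriv a f)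
    (h : b ∈ OrbitBar a) : ∃ f, IsACDeriv b f := by
  obtain ⟨f, ha⟩ := ha
  obtain ⟨g, hg, he⟩ := exists_density_of_mem_orbitBar h
  exact ⟨_, (ha.comp hg).congr he⟩

lemma sameArcLengthCurve_of_mem_closure {c x g f : ℝ → E d} (hc : IsACDeriv c g)
    (hx : IsACDeriv x f) (h : x ∈ ACClosure (Orbit c)) : SameArcLengthCurve x f c g := by
  have h1 : (1:ℝ) ∈ Icc (0:ℝ) 1 := right_mem_Icc.2 zero_le_one
  have key : ∀ ε > 0, ∃ y k γ, IsACDeriv y k ∧ IsUnitDensity γ ∧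
      EqOn y (c ∘ primitive γ) (Icc 0 1) ∧ ACnorm (x - y) < ε := by
    intro ε hε
    obtain ⟨y, ⟨γ, hγ, hy⟩, hlt⟩ := h.2 ε hε
    have hyc : y ∈ OrbitBar c := ⟨γ, hγ.memGammaBar, hy⟩
    obtain ⟨k, hk⟩ := exists_isACDeriv_of_mem_orbitBar ⟨g, hc⟩ hyc
    obtain ⟨γ', hγ', he⟩ := exists_density_of_mem_orbitBar hyc
    exact ⟨y, k, γ', hk, hγ', he, hlt⟩
  refine ⟨?_, fun s hs t ht hst => ?_⟩
  · refine eq_of_abs_sub_le_all fun ε hε => ?_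
    obtain ⟨y, k, γ, hy, hγ, he, hlt⟩ := key ε hε
    have h2 := abs_arcLength_sub_le_ACnorm hx hy h1
    rw [arcLength_of_eqOn_comp hc hy hγ he h1, hγ.primitive_one] at h2
    exact h2.trans hlt.le
  · rw [← sub_eq_zero, ← norm_le_zero_iff]
    refine le_of_forall_pos_le_add fun ε hε => ?_
    obtain ⟨y, k, γ, hy, hγ, he, hlt⟩ := key (ε / 2) (half_pos hε)
    have h2 := abs_arcLength_sub_le_ACnorm hx hy hs
    have h3 := norm_sub_le_ACnorm ⟨_, hx⟩ ⟨_, hy⟩ hs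
    have h4 := norm_sub_le_integral hc (hγ.primitive_mem_Icc s) ht
    rw [← hst, ← arcLength_of_eqOn_comp hc hy hγ he hs, norm_sub_rev] at h4
    have h5 : y s = c (primitive γ s) := he hs
    rw [← h5] at h4
    linarith [norm_sub_le_norm_sub_add_norm_sub (x s) (y s) (c t)]

lemma mem_closure_orbit_of_mem_orbitBar {a c x : ℝ → E d} (ha : ∃ f, IsACDeriv a f)
    (hca : c ∈ OrbitBar a) (hxa : x ∈ OrbitBar a) : x ∈ ACClosure (Orbit c) := by
  have hc := exists_isACDeriv_of_mem_orbitBar ha hca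
  have hx := exists_isACDeriv_of_mem_orbitBar ha hxa
  refine ⟨hx, fun ε hε => ?_⟩
  obtain ⟨f, ha⟩ := ha
  obtain ⟨β, hβ, eβ⟩ := exists_density_of_mem_orbitBar hxa
  obtain ⟨γ, hγ, eγ⟩ := exists_density_of_mem_orbitBar hca
  obtain ⟨β', hβ', mβ', lβ⟩ := exists_memGamma_approx ha hβ (half_pos hε)
  obtain ⟨γ', hγ', mγ', lγ⟩ := exists_memGamma_approx ha hγ (half_pos hε)
  obtain ⟨η, mη, hη⟩ := mγ'.exists_rightInverse
  obtain ⟨κ, hκ, -, eκ⟩ := memGamma_iff.1 (mη.comp mβ')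
  have hy : ∃ f, IsACDeriv (c ∘ primitive κ) f := let ⟨_, h⟩ := hc; ⟨_, h.comp hκ⟩
  have haβ' : ∃ f, IsACDeriv (a ∘ primitive β') f := ⟨_, ha.comp hβ'⟩
  have haγ' : ∃ f, IsACDeriv (a ∘ primitive γ') f := ⟨_, ha.comp hγ'⟩
  have hcγ' : ∃ f, IsACDeriv (c - a ∘ primitive γ') f :=
    let ⟨_, h⟩ := hc; ⟨_, h.sub (ha.comp hγ')⟩
  refine ⟨c ∘ primitive κ, ⟨_, mη.comp mβ', fun t ht => by rw [eκ ht]; rfl⟩, ?_⟩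
  have e1 : ACnorm (x - a ∘ primitive β') < ε / 2 := by
    rw [ACnorm_congr (x := a ∘ primitive β - a ∘ primitive β')
      ⟨_, (ha.comp hβ).sub (ha.comp hβ')⟩ fun t ht => by rw [Pi.sub_apply, eβ ht]; rfl]
    exact lβ
  have e2 : ACnorm (c - a ∘ primitive γ') < ε / 2 := by
    rw [ACnorm_congr (x := a ∘ primitive γ - a ∘ primitive γ')
      ⟨_, (ha.comp hγ).sub (ha.comp hγ')⟩ fun t ht => by rw [Pi.sub_apply, eγ ht]; rfl]
    exact lγ
  have e3 : ACnorm (c ∘ primitive κ - a ∘ primitive β') < ε / 2 := by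
    rw [ACnorm_congr (x := (c - a ∘ primitive γ') ∘ primitive κ)
      (let ⟨_, h⟩ := hcγ'; ⟨_, h.comp hκ⟩), ACnorm_comp hcγ' hκ]
    · exact e2
    · intro t ht
      have h2 : primitive γ' (primitive κ t) = primitive β' t := by
        rw [← eκ ht]
        exact hη _ (hβ'.primitive_mem_Icc t)
      simp [h2]
  rw [ACnorm_sub_comm hy haβ'] at e3
  linarith [ACnorm_sub_le hx haβ' hy]

lemma mem_orbitBar_self (c : ℝ → E d) : c ∈ OrbitBar c :=
  ⟨id, memGamma_id.memGammaBar, fun _ _ => rfl⟩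

lemma setOf_common_orbitBar_eq_closure {c g : ℝ → E d} (hc : IsACDeriv c g) :
    {x : ℝ → E d | (∃ fx, IsACDeriv x fx) ∧
      ∃ a : ℝ → E d, (∃ fa, IsACDeriv a fa) ∧ c ∈ OrbitBar a ∧ x ∈ OrbitBar a} =
    ACClosure (Orbit c) := by
  ext x
  constructor
  · rintro ⟨-, a, ha, hca, hxa⟩
    exact mem_closure_orbit_of_mem_orbitBar ha hca hxa
  · intro h
    obtain ⟨f, hx⟩ := h.1
    exact ⟨h.1, (sameArcLengthCurve_of_mem_closure hc hx h).symm.exists_orbitBar hc hx⟩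

lemma equivalence_common_orbitBar (d : ℕ) :
    Equivalence (fun b c : {x : ℝ → E d // ∃ f, IsACDeriv x f} =>
      ∃ a : ℝ → E d, (∃ fa, IsACDeriv a fa) ∧ b.1 ∈ OrbitBar a ∧ c.1 ∈ OrbitBar a) where
  refl b := ⟨b.1, b.2, mem_orbitBar_self _, mem_orbitBar_self _⟩
  symm := fun ⟨a, ha, hb, hc⟩ => ⟨a, ha, hc, hb⟩
  trans := by
    rintro ⟨b, f, hb⟩ ⟨c, g, hc⟩ ⟨e, k, he⟩ ⟨a, ha, hba, hca⟩ ⟨a', ha', hca', hea'⟩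
    exact ((sameArcLengthCurve_of_mem_orbitBar ha hb hc hba hca).trans hb hc
      (sameArcLengthCurve_of_mem_orbitBar ha' hc he hca' hea')).exists_orbitBar hb he

end Equivalence

/-- for `b, c ∈ AC₀([0,1],ℝ^d)` the following are equivalent:
(1) there exist `a ∈ AC₀([0,1],ℝ^d)` and `β, γ ∈ Γ̄` with `b = a ∘ β` and `c = a ∘ γ`;
(2) the AC closures of `b ∘ Γ` and `c ∘ Γ` coincide.
In particular (1) defines an equivalence relation on `AC₀([0,1],ℝ^d)`, whose equivalence
classes are the AC closures of the orbits `c ∘ Γ`. -/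
theorem stmt_14 (d : ℕ) :
    (∀ (b c : ℝ → E d) (fb fc : ℝ → E d), IsACDeriv b fb → IsACDeriv c fc →
      ((∃ a : ℝ → E d, (∃ fa, IsACDeriv a fa) ∧ b ∈ OrbitBar a ∧ c ∈ OrbitBar a) ↔
        ACClosure (Orbit b) = ACClosure (Orbit c))) ∧
    Equivalence (fun b c : {x : ℝ → E d // ∃ f, IsACDeriv x f} =>
      ∃ a : ℝ → E d, (∃ fa, IsACDeriv a fa) ∧ b.1 ∈ OrbitBar a ∧ c.1 ∈ OrbitBar a) ∧
    (∀ (c : ℝ → E d) (fc : ℝ → E d), IsACDeriv c fc →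
      {x : ℝ → E d | (∃ fx, IsACDeriv x fx) ∧
          ∃ a : ℝ → E d, (∃ fa, IsACDeriv a fa) ∧ c ∈ OrbitBar a ∧ x ∈ OrbitBar a} =
        ACClosure (Orbit c)) := by
  have hE := equivalence_common_orbitBar d
  refine ⟨fun b c fb fc hb hc => ⟨fun h => ?_, fun h => ?_⟩, hE, fun c fc hc =>
    setOf_common_orbitBar_eq_closure hc⟩
  · rw [← setOf_common_orbitBar_eq_closure hb, ← setOf_common_orbitBar_eq_closure hc]
    ext x
    refine and_congr_right fun hx => ⟨fun hbx => ?_, fun hcx => ?_⟩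
    · exact hE.trans (x := ⟨c, _, hc⟩) (y := ⟨b, _, hb⟩) (z := ⟨x, hx⟩)
        (hE.symm (x := ⟨b, _, hb⟩) (y := ⟨c, _, hc⟩) h) hbx
    · exact hE.trans (x := ⟨b, _, hb⟩) (y := ⟨c, _, hc⟩) (z := ⟨x, hx⟩) h hcx
  · have hmem : c ∈ ACClosure (Orbit b) := by
      rw [h]
      exact mem_closure_orbit_of_mem_orbitBar ⟨_, hc⟩ (mem_orbitBar_self c) (mem_orbitBar_self c)
    rw [← setOf_common_orbitBar_eq_closure hb] at hmem
    exact hmem.2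
end
end

section
/- Let b, c ∈ C¹([0,1],ℝ^d) with b(0) = c(0) = 0 and b' ≠ 0, c' ≠ 0 almost everywhere. Then there exist β, γ ∈ Γ̄ such that dist(b ∘ β, c ∘ γ) = inf_{β',γ' ∈ Γ̄} dist(b ∘ β', c ∘ γ'); i.e. the infimum defining the quotient distance between the unparametrised curves represented by b and c is attained by a pair of optimal reparametrisations. -/
open MeasureTheory Set Filter
open scoped NNReal ENNReal

noncomputable section

/-- The square root velocity distance `dist(b,c) = ‖R b - R c‖_{L²}` on `AC₀([0,1],ℝ^d)`
(and `0` if one of the arguments is not such a curve). -/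
def SRVdist {d : ℕ} (b c : ℝ → E d) : ℝ := by
  classical exact
    if hb : ∃ f, IsACDeriv b f then
      if hc : ∃ f, IsACDeriv c f then
        Real.sqrt (∫ t in (0:ℝ)..1, ‖V (hb.choose t) - V (hc.choose t)‖ ^ 2)
      else 0
    else 0

/-- The quotient distance `D(b,c) = inf_{β,γ ∈ Γ̄} dist(b ∘ β, c ∘ γ)` on shape space. -/
def QD {d : ℕ} (b c : ℝ → E d) : ℝ :=
  sInf {r : ℝ | ∃ β γ, MemGammaBar β ∧ MemGammaBar γ ∧ r = SRVdist (b ∘ β) (c ∘ γ)}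

/-- `g` is the everywhere nonnegative speed of a reparametrisation in `Γ̄`. -/
structure IsSpeed (g : ℝ → ℝ) : Prop where
  stronglyMeasurable : StronglyMeasurable g
  integrable : Integrable g
  nonneg : ∀ t, 0 ≤ g t
  total : ∫ t in (0:ℝ)..1, g t = 1

/-- The primitive of `g` vanishing at `0`. -/
def prim (g : ℝ → ℝ) (t : ℝ) : ℝ := ∫ τ in (0:ℝ)..t, g τ

theorem IsSpeed.memGammaBar {g : ℝ → ℝ} (hg : IsSpeed g) : MemGammaBar (prim g) :=
  ⟨g, ⟨hg.stronglyMeasurable, hg.integrable.integrableOn, fun _ _ => rfl⟩,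
    Eventually.of_forall hg.nonneg, hg.total⟩

theorem MemGammaBar.exists_isSpeed {γ : ℝ → ℝ} (h : MemGammaBar γ) :
    ∃ g, IsSpeed g ∧ EqOn γ (prim g) (Icc 0 1) := by
  obtain ⟨g, ⟨hm, hi, hp⟩, h0, h1⟩ := h
  have key : ∀ t ∈ Icc (0:ℝ) 1, γ t = prim ((Icc (0:ℝ) 1).indicator fun t => max (g t) 0) t := by
    intro t ht
    rw [hp t ht, prim]
    refine intervalIntegral.integral_congr_ae ?_
    rw [ae_restrict_iff' measurableSet_Icc] at h0
    filter_upwards [h0] with x hx hxt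
    rw [uIoc_of_le ht.1] at hxt
    have hx' : x ∈ Icc (0:ℝ) 1 := ⟨hxt.1.le, hxt.2.trans ht.2⟩
    rw [indicator_of_mem hx', max_eq_left (hx hx')]
  refine ⟨(Icc (0:ℝ) 1).indicator fun t => max (g t) 0, ⟨?_, ?_, ?_, ?_⟩, key⟩
  · exact (hm.sup stronglyMeasurable_const).indicator measurableSet_Icc
  · rw [integrable_indicator_iff measurableSet_Icc]
    exact hi.pos_part
  · intro t
    exact indicator_nonneg (fun _ _ => le_max_right _ _) t
  · exact (key 1 (by simp)).symm.trans h1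

namespace IsSpeed

variable {g : ℝ → ℝ}

theorem intervalIntegrable (hg : IsSpeed g) (a b : ℝ) : IntervalIntegrable g volume a b :=
  hg.integrable.intervalIntegrable

theorem prim_sub (hg : IsSpeed g) (u v : ℝ) : prim g v - prim g u = ∫ t in u..v, g t :=
  intervalIntegral.integral_interval_sub_left (hg.intervalIntegrable _ _)
    (hg.intervalIntegrable _ _)

theorem continuous_prim (hg : IsSpeed g) : Continuous (prim g) :=
  intervalIntegral.continuous_primitive (fun _ _ => hg.intervalIntegrable _ _) 0

theorem monotone_prim (hg : IsSpeed g) : Monotone (prim g) := by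
  intro u v huv
  have := intervalIntegral.integral_nonneg huv (fun t _ => hg.nonneg t) (μ := volume)
  rw [← hg.prim_sub] at this
  linarith

theorem _root_.prim_zero (g : ℝ → ℝ) : prim g 0 = 0 := intervalIntegral.integral_same

theorem prim_one (hg : IsSpeed g) : prim g 1 = 1 := hg.total

theorem prim_mem (hg : IsSpeed g) {t : ℝ} (ht : t ∈ Icc (0:ℝ) 1) : prim g t ∈ Icc (0:ℝ) 1 :=
  ⟨by simpa [prim_zero] using hg.monotone_prim ht.1,
    by simpa [hg.prim_one] using hg.monotone_prim ht.2⟩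

theorem ae_hasDerivAt_prim (hg : IsSpeed g) : ∀ᵐ t, HasDerivAt (prim g) (g t) t := by
  filter_upwards [LocallyIntegrable.ae_hasDerivAt_integral hg.integrable.locallyIntegrable] with t ht
  exact ht 0

theorem absolutelyContinuous_prim (hg : IsSpeed g) (a b : ℝ) :
    AbsolutelyContinuousOnInterval (prim g) a b := by
  have h := ((hg.intervalIntegrable a b).absolutelyContinuousOnInterval_intervalIntegral
    (c := a) left_mem_uIcc)
  have h2 : AbsolutelyContinuousOnInterval (fun _ : ℝ => prim g a) a b :=
    (LipschitzWith.const (prim g a)).lipschitzOnWith.absolutelyContinuousOnInterval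
  have e : prim g = (fun x => ∫ v in a..x, g v) + fun _ => prim g a := by
    funext x
    change prim g x = (∫ v in a..x, g v) + prim g a
    rw [← hg.prim_sub, sub_add_cancel]
  rw [e]
  exact h.add h2

end IsSpeed

theorem AbsolutelyContinuousOnInterval.of_dist_le {X Y : Type*} [PseudoMetricSpace X]
    [PseudoMetricSpace Y] {f : ℝ → X} {g : ℝ → Y} {a b C : ℝ}
    (hg : AbsolutelyContinuousOnInterval g a b)
    (h : ∀ u ∈ uIcc a b, ∀ v ∈ uIcc a b, dist (f u) (f v) ≤ C * dist (g u) (g v)) :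
    AbsolutelyContinuousOnInterval f a b := by
  rw [absolutelyContinuousOnInterval_iff] at hg ⊢
  intro ε hε
  obtain ⟨δ, hδ, H⟩ := hg (ε / (|C| + 1)) (by positivity)
  refine ⟨δ, hδ, fun E hE hs => ?_⟩
  have h1 := H E hE hs
  rw [lt_div_iff₀ (by positivity)] at h1
  refine lt_of_le_of_lt ?_ h1
  rw [Finset.sum_mul]
  refine Finset.sum_le_sum fun i hi => ?_
  have h2 := h _ (hE.1 i hi).1 _ (hE.1 i hi).2
  have h3 := dist_nonneg (x := g (E.2 i).1) (y := g (E.2 i).2)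
  nlinarith [le_abs_self C]

theorem intervalIntegrable_speed_smul {F : Type*} [NormedAddCommGroup F] [NormedSpace ℝ F]
    {φ : ℝ → F} (hφ : Continuous φ) {g : ℝ → ℝ} (hg : IsSpeed g) (a b : ℝ) :
    IntervalIntegrable (fun t => g t • φ (prim g t)) volume a b :=
  (hg.intervalIntegrable a b).smul_continuousOn (hφ.comp hg.continuous_prim).continuousOn

/-- Change of variables for an absolutely continuous reparametrisation. -/
theorem integral_speed_smul {F : Type*} [NormedAddCommGroup F] [NormedSpace ℝ F]
    [CompleteSpace F] {φ : ℝ → F} (hφ : Continuous φ) {g : ℝ → ℝ} (hg : IsSpeed g) {t : ℝ}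
    (ht : t ∈ Icc (0:ℝ) 1) :
    ∫ τ in (0:ℝ)..t, g τ • φ (prim g τ) = ∫ x in (0:ℝ)..prim g t, φ x := by
  obtain ⟨M, hM⟩ := isCompact_Icc.exists_bound_of_continuousOn (s := Icc (0:ℝ) 1)
    hφ.continuousOn
  set H : ℝ → F := fun t => (∫ τ in (0:ℝ)..t, g τ • φ (prim g τ)) -
    ∫ x in (0:ℝ)..prim g t, φ x with hH
  have hii := intervalIntegrable_speed_smul hφ hg
  have hac : AbsolutelyContinuousOnInterval H 0 1 := by
    refine (hg.absolutelyContinuous_prim 0 1).of_dist_le (C := 2 * M) ?_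
    have key : ∀ u ∈ Icc (0:ℝ) 1, ∀ v ∈ Icc (0:ℝ) 1, u ≤ v →
        dist (H v) (H u) ≤ 2 * M * dist (prim g v) (prim g u) := by
      intro u hu v hv huv
      have e : H v - H u = (∫ τ in u..v, g τ • φ (prim g τ)) -
          ∫ x in prim g u..prim g v, φ x := by
        rw [← intervalIntegral.integral_interval_sub_left (hii 0 v) (hii 0 u),
          ← intervalIntegral.integral_interval_sub_left (hφ.intervalIntegrable 0 _)
            (hφ.intervalIntegrable 0 _)]
        simp only [hH]; abel
      have hmono := hg.monotone_prim huv
      rw [dist_eq_norm, e, Real.dist_eq, abs_of_nonneg (sub_nonneg.2 hmono)]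
      have h1 : ‖∫ τ in u..v, g τ • φ (prim g τ)‖ ≤ ∫ τ in u..v, g τ * M := by
        refine intervalIntegral.norm_integral_le_of_norm_le huv ?_
          ((hg.intervalIntegrable u v).mul_const M)
        refine Eventually.of_forall fun τ hτ => ?_
        rw [norm_smul, Real.norm_of_nonneg (hg.nonneg τ)]
        exact mul_le_mul_of_nonneg_left
          (hM _ (hg.prim_mem ⟨hu.1.trans hτ.1.le, hτ.2.trans hv.2⟩)) (hg.nonneg τ)
      have h2 : ‖∫ x in prim g u..prim g v, φ x‖ ≤ M * |prim g v - prim g u| := by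
        refine intervalIntegral.norm_integral_le_of_norm_le_const fun x hx => ?_
        rw [uIoc_of_le hmono] at hx
        exact hM _ ⟨(hg.prim_mem hu).1.trans hx.1.le, hx.2.trans (hg.prim_mem hv).2⟩
      rw [intervalIntegral.integral_mul_const, ← hg.prim_sub] at h1
      rw [abs_of_nonneg (sub_nonneg.2 hmono)] at h2
      linarith [norm_sub_le (∫ τ in u..v, g τ • φ (prim g τ)) (∫ x in prim g u..prim g v, φ x)]
    rw [uIcc_of_le zero_le_one]
    intro u hu v hv
    rcases le_total u v with huv | huv
    · rw [dist_comm, dist_comm (prim g u)]; exact key u hu v hv huv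
    · exact key v hv u hu huv
  have hd : ∀ᵐ x, x ∈ uIcc (0:ℝ) 1 → HasDerivAt H 0 x := by
    filter_upwards [(hii 0 1).ae_hasDerivAt_integral, hg.ae_hasDerivAt_prim] with x h1 h2 hx
    have h3 := h1 hx 0 left_mem_uIcc
    have h4 : HasDerivAt (fun y => ∫ x in (0:ℝ)..y, φ x) (φ (prim g x)) (prim g x) :=
      intervalIntegral.integral_hasDerivAt_right (hφ.intervalIntegrable _ _)
        hφ.stronglyMeasurable.stronglyMeasurableAtFilter hφ.continuousAt
    have h5 := h3.sub (h4.scomp x h2)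
    rw [sub_self] at h5
    exact h5
  obtain ⟨C, hC⟩ := hac.const_of_ae_hasDerivAt_zero hd
  rw [uIcc_of_le zero_le_one] at hC
  have h0 := hC 0 (by simp)
  have ht' := hC t ht
  rw [← h0] at ht'
  simp only [hH, prim_zero, intervalIntegral.integral_same, sub_self] at ht'
  exact sub_eq_zero.1 ht'

theorem IsACDeriv.ae_unique {d : ℕ} {x f f' : ℝ → E d} (h : IsACDeriv x f)
    (h' : IsACDeriv x f') : ∀ᵐ t, t ∈ Ioo (0:ℝ) 1 → f t = f' t := by
  have hi : IntervalIntegrable f volume 0 1 := by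
    rw [intervalIntegrable_iff_integrableOn_Icc_of_le zero_le_one]; exact h.2.1
  have hi' : IntervalIntegrable f' volume 0 1 := by
    rw [intervalIntegrable_iff_integrableOn_Icc_of_le zero_le_one]; exact h'.2.1
  filter_upwards [hi.ae_hasDerivAt_integral, hi'.ae_hasDerivAt_integral] with t h1 h2 ht
  rw [uIcc_of_le zero_le_one] at h1 h2
  have ht' := Ioo_subset_Icc_self ht
  have h3 := h1 ht' 0 (by simp)
  have h4 := h2 ht' 0 (by simp)
  refine h3.unique (h4.congr_of_eventuallyEq ?_)
  filter_upwards [isOpen_Ioo.mem_nhds ht] with s hs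
  rw [← h.2.2 s (Ioo_subset_Icc_self hs), ← h'.2.2 s (Ioo_subset_Icc_self hs)]

theorem SRVdist_eq {d : ℕ} {b c fb fc : ℝ → E d} (hb : IsACDeriv b fb) (hc : IsACDeriv c fc) :
    SRVdist b c = Real.sqrt (∫ t in (0:ℝ)..1, ‖V (fb t) - V (fc t)‖ ^ 2) := by
  have hb' : ∃ f, IsACDeriv b f := ⟨fb, hb⟩
  have hc' : ∃ f, IsACDeriv c f := ⟨fc, hc⟩
  rw [SRVdist, dif_pos hb', dif_pos hc']
  congr 1
  refine intervalIntegral.integral_congr_ae ?_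
  have h1 : ∀ᵐ t : ℝ, t ≠ 1 := by simp [ae_iff, measure_singleton]
  filter_upwards [hb'.choose_spec.ae_unique hb, hc'.choose_spec.ae_unique hc, h1] with t h2 h3 h4 h5
  rw [uIoc_of_le zero_le_one] at h5
  have h6 : t ∈ Ioo (0:ℝ) 1 := ⟨h5.1, lt_of_le_of_ne h5.2 h4⟩
  rw [h2 h6, h3 h6]

/-- Extension of a function on `[0,1]` to the line by its boundary values. -/
def clampExt {F : Type*} (f : ℝ → F) (x : ℝ) : F := f (max 0 (min 1 x))

theorem clampExt_of_mem {F : Type*} (f : ℝ → F) {x : ℝ} (hx : x ∈ Icc (0:ℝ) 1) :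
    clampExt f x = f x := by
  rw [clampExt, min_eq_right hx.2, max_eq_right hx.1]

theorem continuous_clampExt {F : Type*} [TopologicalSpace F] {f : ℝ → F}
    (hf : ContinuousOn f (Icc 0 1)) : Continuous (clampExt f) :=
  hf.comp_continuous (by fun_prop) fun x => ⟨le_max_left _ _, max_le zero_le_one (min_le_left _ _)⟩

theorem IsACDeriv.comp_speed {d : ℕ} {b fb : ℝ → E d} (hb : IsACDeriv b fb)
    (hfb : ContinuousOn fb (Icc (0:ℝ) 1)) {β g : ℝ → ℝ} (hg : IsSpeed g)
    (hβ : EqOn β (prim g) (Icc 0 1)) :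
    IsACDeriv (b ∘ β) (fun t => g t • clampExt fb (prim g t)) := by
  have hφ := continuous_clampExt hfb
  refine ⟨hg.stronglyMeasurable.smul (hφ.comp hg.continuous_prim).stronglyMeasurable, ?_, ?_⟩
  · rw [← intervalIntegrable_iff_integrableOn_Icc_of_le zero_le_one]
    exact intervalIntegrable_speed_smul hφ hg 0 1
  · intro t ht
    have hm := hg.prim_mem ht
    rw [Function.comp_apply, hβ ht, hb.2.2 _ hm, integral_speed_smul hφ hg ht]
    refine intervalIntegral.integral_congr fun x hx => ?_
    rw [uIcc_of_le hm.1] at hx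
    exact (clampExt_of_mem fb ⟨hx.1, hx.2.trans hm.2⟩).symm

theorem norm_V_sq {d : ℕ} (x : E d) : ‖V x‖ ^ 2 = ‖x‖ := by
  rw [V, norm_smul, mul_pow, norm_inv, Real.norm_of_nonneg (Real.sqrt_nonneg _), inv_pow,
    Real.sq_sqrt (norm_nonneg _)]
  rcases eq_or_ne ‖x‖ 0 with h | h
  · simp [h]
  · field_simp

theorem V_smul {d : ℕ} {r : ℝ} (hr : 0 ≤ r) (x : E d) : V (r • x) = Real.sqrt r • V x := by
  rw [V, V, norm_smul, Real.norm_of_nonneg hr, Real.sqrt_mul hr, smul_smul, smul_smul]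
  congr 1
  rcases eq_or_ne r 0 with h | h
  · simp [h]
  · have h1 : Real.sqrt r ≠ 0 := (Real.sqrt_pos.2 (lt_of_le_of_ne hr h.symm)).ne'
    have h2 := Real.mul_self_sqrt hr
    rw [mul_inv, mul_right_comm]
    congr 1
    field_simp
    linarith

theorem continuous_V {d : ℕ} : Continuous (V : E d → E d) := by
  rw [continuous_iff_continuousAt]
  intro x
  rcases eq_or_ne x 0 with rfl | hx
  · have h0 : V (0 : E d) = 0 := by simp [V]
    rw [ContinuousAt, h0, tendsto_zero_iff_norm_tendsto_zero]
    have h1 : ∀ y : E d, ‖V y‖ = Real.sqrt ‖y‖ := fun y => by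
      rw [← norm_V_sq y, Real.sqrt_sq (norm_nonneg _)]
    simp only [h1]
    have : Continuous fun y : E d => Real.sqrt ‖y‖ := by fun_prop
    simpa using this.tendsto 0
  · have h1 : Real.sqrt ‖x‖ ≠ 0 := (Real.sqrt_pos.2 (norm_pos_iff.2 hx)).ne'
    have h2 : ContinuousAt (fun y : E d => Real.sqrt ‖y‖) x := by fun_prop
    exact (h2.inv₀ h1).smul continuousAt_id

/-- The correlation of two curves along the reparametrisations with speeds `g` and `h`. -/
def correlation (ψ : ℝ → ℝ → ℝ) (g h : ℝ → ℝ) : ℝ :=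
  ∫ t in (0:ℝ)..1, ψ (prim g t) (prim h t) * Real.sqrt (g t * h t)

theorem intervalIntegrable_sqrt_mul {g h : ℝ → ℝ} (hg : IsSpeed g) (hh : IsSpeed h) (a b : ℝ) :
    IntervalIntegrable (fun t => Real.sqrt (g t * h t)) volume a b := by
  refine ((hg.intervalIntegrable a b).add (hh.intervalIntegrable a b)).mono_fun ?_ ?_
  · exact ((hg.stronglyMeasurable.measurable.mul
      hh.stronglyMeasurable.measurable).sqrt).aestronglyMeasurable
  · refine Eventually.of_forall fun t => ?_
    have h1 := hg.nonneg t
    have h2 := hh.nonneg t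
    change ‖Real.sqrt (g t * h t)‖ ≤ ‖g t + h t‖
    rw [Real.norm_of_nonneg (Real.sqrt_nonneg _), Real.norm_of_nonneg (add_nonneg h1 h2)]
    exact Real.sqrt_le_iff.2 ⟨by positivity, by nlinarith⟩

theorem intervalIntegrable_correlation {ψ : ℝ → ℝ → ℝ} (hψ : Continuous fun p : ℝ × ℝ => ψ p.1 p.2)
    {g h : ℝ → ℝ} (hg : IsSpeed g) (hh : IsSpeed h) (a b : ℝ) :
    IntervalIntegrable (fun t => ψ (prim g t) (prim h t) * Real.sqrt (g t * h t)) volume a b :=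
  (intervalIntegrable_sqrt_mul hg hh a b).continuousOn_mul
    (hψ.comp (hg.continuous_prim.prodMk hh.continuous_prim)).continuousOn

theorem SRVdist_comp {d : ℕ} {b c fb fc : ℝ → E d} (hb : IsACDeriv b fb) (hc : IsACDeriv c fc)
    (hfb : ContinuousOn fb (Icc (0:ℝ) 1)) (hfc : ContinuousOn fc (Icc (0:ℝ) 1))
    {β γ g h : ℝ → ℝ} (hg : IsSpeed g) (hβ : EqOn β (prim g) (Icc 0 1))
    (hh : IsSpeed h) (hγ : EqOn γ (prim h) (Icc 0 1)) :
    SRVdist (b ∘ β) (c ∘ γ) = Real.sqrt ((∫ x in (0:ℝ)..1, ‖clampExt fb x‖) +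
      (∫ x in (0:ℝ)..1, ‖clampExt fc x‖) -
      2 * correlation (fun x y => inner ℝ (V (clampExt fb x)) (V (clampExt fc y))) g h) := by
  have hφ := continuous_clampExt hfb
  have hχ := continuous_clampExt hfc
  set ψ : ℝ → ℝ → ℝ := fun x y => inner ℝ (V (clampExt fb x)) (V (clampExt fc y)) with hψ_def
  have hψ : Continuous fun p : ℝ × ℝ => ψ p.1 p.2 :=
    (continuous_V.comp (hφ.comp continuous_fst)).inner (continuous_V.comp (hχ.comp continuous_snd))
  rw [SRVdist_eq (hb.comp_speed hfb hg hβ) (hc.comp_speed hfc hh hγ)]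
  congr 1
  have e1 := integral_speed_smul hφ.norm hg (t := 1) (by simp)
  have e2 := integral_speed_smul hχ.norm hh (t := 1) (by simp)
  rw [hg.prim_one] at e1
  rw [hh.prim_one] at e2
  have i1 := intervalIntegrable_speed_smul hφ.norm hg 0 1
  have i2 := intervalIntegrable_speed_smul hχ.norm hh 0 1
  have i3 := (intervalIntegrable_correlation hψ hg hh 0 1).const_mul 2
  rw [← e1, ← e2, correlation, ← intervalIntegral.integral_add i1 i2,
    ← intervalIntegral.integral_const_mul, ← intervalIntegral.integral_sub (i1.add i2) i3]
  refine intervalIntegral.integral_congr fun t _ => ?_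
  simp only [smul_eq_mul, hψ_def]
  rw [norm_sub_sq_real, norm_V_sq, norm_V_sq, norm_smul, norm_smul,
    Real.norm_of_nonneg (hg.nonneg t), Real.norm_of_nonneg (hh.nonneg t), V_smul (hg.nonneg t),
    V_smul (hh.nonneg t), real_inner_smul_left, real_inner_smul_right,
    Real.sqrt_mul (hg.nonneg t)]
  ring

theorem IsSpeed.integral_sqrt_mul_le {g h : ℝ → ℝ} (hg : IsSpeed g) (hh : IsSpeed h) {u v : ℝ}
    (huv : u ≤ v) :
    ∫ t in u..v, Real.sqrt (g t * h t) ≤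
      Real.sqrt ((prim g v - prim g u) * (prim h v - prim h u)) := by
  set I := ∫ t in u..v, Real.sqrt (g t * h t) with hI
  have key : ∀ x : ℝ, 0 ≤ (prim g v - prim g u) * (x * x) + (-2 * I) * x +
      (prim h v - prim h u) := by
    intro x
    have e : ∫ t in u..v, (x * Real.sqrt (g t) - Real.sqrt (h t)) ^ 2 =
        (prim g v - prim g u) * (x * x) + (-2 * I) * x + (prim h v - prim h u) := by
      rw [hg.prim_sub, hh.prim_sub, hI, ← intervalIntegral.integral_mul_const,
        ← intervalIntegral.integral_const_mul, ← intervalIntegral.integral_mul_const,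
        ← intervalIntegral.integral_add ((hg.intervalIntegrable u v).mul_const _)
          (((intervalIntegrable_sqrt_mul hg hh u v).const_mul _).mul_const _),
        ← intervalIntegral.integral_add _ (hh.intervalIntegrable u v)]
      · refine intervalIntegral.integral_congr fun t _ => ?_
        have h1 := Real.sq_sqrt (hg.nonneg t)
        have h2 := Real.sq_sqrt (hh.nonneg t)
        rw [Real.sqrt_mul (hg.nonneg t)]
        linear_combination x ^ 2 * h1 + h2
      · exact ((hg.intervalIntegrable u v).mul_const _).add
          (((intervalIntegrable_sqrt_mul hg hh u v).const_mul _).mul_const _)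
    rw [← e]
    exact intervalIntegral.integral_nonneg huv fun t _ => sq_nonneg _
  have hd := discrim_le_zero key
  rw [discrim] at hd
  exact Real.le_sqrt_of_sq_le (by nlinarith)

theorem correlation_le_sum {p : ℝ → ℝ → ℝ} (hp : Continuous fun q : ℝ × ℝ => p q.1 q.2)
    (hp0 : ∀ x y, 0 ≤ p x y) {g h : ℝ → ℝ} (hg : IsSpeed g) (hh : IsSpeed h) {ε : ℝ} (hε : 0 ≤ ε)
    {n : ℕ} {t : ℕ → ℝ} (ht0 : t 0 = 0) (htn : t n = 1) (htm : ∀ i < n, t i ≤ t (i + 1))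
    (hosc : ∀ i < n, ∀ s ∈ Icc (t i) (t (i + 1)),
      p (prim g s) (prim h s) ≤ p (prim g (t i)) (prim h (t i)) + ε) :
    correlation p g h ≤ (∑ i ∈ Finset.range n, p (prim g (t i)) (prim h (t i)) *
      Real.sqrt ((prim g (t (i + 1)) - prim g (t i)) * (prim h (t (i + 1)) - prim h (t i)))) + ε := by
  have hi := intervalIntegrable_correlation hp hg hh
  have hj := intervalIntegrable_sqrt_mul hg hh
  rw [correlation, ← ht0, ← htn,
    ← intervalIntegral.sum_integral_adjacent_intervals fun k _ => hi _ _]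
  have e1 : (∑ i ∈ Finset.range n, ε * (((prim g (t (i + 1)) - prim g (t i)) +
      (prim h (t (i + 1)) - prim h (t i))) / 2)) = ε := by
    rw [← Finset.mul_sum, ← Finset.sum_div, Finset.sum_add_distrib,
      Finset.sum_range_sub (fun i => prim g (t i)), Finset.sum_range_sub (fun i => prim h (t i)),
      ht0, htn, hg.prim_one, hh.prim_one, prim_zero, prim_zero]
    norm_num
  refine le_of_le_of_eq ?_ (congrArg _ e1)
  rw [← Finset.sum_add_distrib]
  refine Finset.sum_le_sum fun i hir => ?_
  have hin := Finset.mem_range.1 hir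
  have hle := htm i hin
  set A := prim g (t (i + 1)) - prim g (t i)
  set B := prim h (t (i + 1)) - prim h (t i)
  have hA : 0 ≤ A := sub_nonneg.2 (hg.monotone_prim hle)
  have hB : 0 ≤ B := sub_nonneg.2 (hh.monotone_prim hle)
  have hAB : Real.sqrt (A * B) ≤ (A + B) / 2 :=
    Real.sqrt_le_iff.2 ⟨by positivity, by nlinarith [sq_nonneg (A - B)]⟩
  calc ∫ s in t i..t (i + 1), p (prim g s) (prim h s) * Real.sqrt (g s * h s)
      ≤ ∫ s in t i..t (i + 1), (p (prim g (t i)) (prim h (t i)) + ε) * Real.sqrt (g s * h s) :=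
        intervalIntegral.integral_mono_on hle (hi _ _) ((hj _ _).const_mul _) fun s hs =>
          mul_le_mul_of_nonneg_right (hosc i hin s hs) (Real.sqrt_nonneg _)
    _ ≤ (p (prim g (t i)) (prim h (t i)) + ε) * Real.sqrt (A * B) := by
        rw [intervalIntegral.integral_const_mul]
        exact mul_le_mul_of_nonneg_left (hg.integral_sqrt_mul_le hh hle)
          (add_nonneg (hp0 _ _) hε)
    _ ≤ _ := by
        rw [add_mul]
        gcongr

/-- Monotone `β` for which `u ↦ (β u, 2 u - β u)` is a path from `(0,0)` to `(1,1)` that is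
monotone in both coordinates. -/
def BalancedPath : Set (ℝ → ℝ) :=
  {β | β 0 = 0 ∧ β 1 = 1 ∧ ∀ u v, u ≤ v → 0 ≤ β v - β u ∧ β v - β u ≤ 2 * (v - u)}

/-- The second coordinate of the path `u ↦ (β u, 2 u - β u)`. -/
def complementary (β : ℝ → ℝ) (u : ℝ) : ℝ := 2 * u - β u

theorem isCompact_balancedPath : IsCompact BalancedPath := by
  have h1 : IsCompact (Set.pi univ fun x : ℝ => Icc (-(2 * |x|)) (2 * |x|)) :=
    isCompact_univ_pi fun _ => isCompact_Icc
  refine h1.of_isClosed_subset ?_ ?_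
  · have e : BalancedPath = {β : ℝ → ℝ | β 0 = 0} ∩ {β | β 1 = 1} ∩ ⋂ (u : ℝ) (v : ℝ) (_ : u ≤ v),
        ({β | 0 ≤ β v - β u} ∩ {β | β v - β u ≤ 2 * (v - u)}) := by
      ext β
      simp [BalancedPath, and_assoc]
    rw [e]
    refine IsClosed.inter (IsClosed.inter ?_ ?_) ?_
    · exact isClosed_eq (continuous_apply _) continuous_const
    · exact isClosed_eq (continuous_apply _) continuous_const
    · refine isClosed_iInter fun u => isClosed_iInter fun v => isClosed_iInter fun _ => ?_
      exact (isClosed_le continuous_const (by fun_prop)).inter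
        (isClosed_le (by fun_prop) continuous_const)
  · rintro β ⟨h0, -, h⟩ x -
    change β x ∈ Icc (-(2 * |x|)) (2 * |x|)
    rcases le_total 0 x with hx | hx
    · have := h 0 x hx
      rw [abs_of_nonneg hx]
      constructor <;> linarith
    · have := h x 0 hx
      rw [abs_of_nonpos hx]
      constructor <;> linarith

theorem id_mem_balancedPath : (id : ℝ → ℝ) ∈ BalancedPath :=
  ⟨rfl, rfl, fun u v huv => by constructor <;> simp only [id] <;> linarith⟩

theorem complementary_mem {β : ℝ → ℝ} (hβ : β ∈ BalancedPath) : complementary β ∈ BalancedPath := by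
  refine ⟨?_, ?_, fun u v huv => ?_⟩
  · simp [complementary, hβ.1]
  · simp only [complementary, hβ.2.1]; norm_num
  · have := hβ.2.2 u v huv
    simp only [complementary]
    constructor <;> linarith

theorem BalancedPath.monotone {β : ℝ → ℝ} (hβ : β ∈ BalancedPath) : Monotone β := fun u v huv =>
  sub_nonneg.1 (hβ.2.2 u v huv).1

theorem BalancedPath.lipschitz {β : ℝ → ℝ} (hβ : β ∈ BalancedPath) : LipschitzWith 2 β := by
  refine LipschitzWith.of_dist_le_mul fun u v => ?_
  simp only [NNReal.coe_ofNat, Real.dist_eq]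
  rcases le_total u v with h | h
  · have := hβ.2.2 u v h
    rw [abs_sub_comm, abs_of_nonneg this.1, abs_sub_comm, abs_of_nonneg (by linarith)]
    exact this.2
  · have := hβ.2.2 v u h
    rw [abs_of_nonneg this.1, abs_of_nonneg (by linarith)]
    exact this.2

theorem BalancedPath.mem_Icc {β : ℝ → ℝ} (hβ : β ∈ BalancedPath) {u : ℝ} (hu : u ∈ Icc (0:ℝ) 1) :
    β u ∈ Icc (0:ℝ) 1 :=
  ⟨hβ.1 ▸ BalancedPath.monotone hβ hu.1, hβ.2.1 ▸ BalancedPath.monotone hβ hu.2⟩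

/-- The derivative of a function, cut off outside `[0,1]`. -/
def speed (β : ℝ → ℝ) : ℝ → ℝ := (Icc (0:ℝ) 1).indicator (deriv β)

theorem BalancedPath.prim_speed {β : ℝ → ℝ} (hβ : β ∈ BalancedPath) :
    EqOn β (prim (speed β)) (Icc 0 1) := by
  intro t ht
  have h1 := ((BalancedPath.lipschitz hβ).lipschitzOnWith
    (s := uIcc 0 t)).absolutelyContinuousOnInterval.integral_deriv_eq_sub
  rw [hβ.1, sub_zero] at h1
  rw [prim, ← h1]
  refine intervalIntegral.integral_congr fun x hx => ?_
  rw [uIcc_of_le ht.1] at hx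
  exact (indicator_of_mem (show x ∈ Icc (0:ℝ) 1 from ⟨hx.1, hx.2.trans ht.2⟩) _).symm

theorem BalancedPath.isSpeed {β : ℝ → ℝ} (hβ : β ∈ BalancedPath) : IsSpeed (speed β) where
  stronglyMeasurable := (stronglyMeasurable_deriv β).indicator measurableSet_Icc
  integrable := by
    have h1 := ((BalancedPath.lipschitz hβ).lipschitzOnWith
      (s := uIcc 0 1)).absolutelyContinuousOnInterval.intervalIntegrable_deriv
    rw [intervalIntegrable_iff_integrableOn_Icc_of_le zero_le_one] at h1
    exact h1.integrable_indicator measurableSet_Icc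
  nonneg t := indicator_nonneg (fun _ _ => (BalancedPath.monotone hβ).deriv_nonneg) _
  total := by
    have := BalancedPath.prim_speed hβ (show (1:ℝ) ∈ Icc (0:ℝ) 1 by simp)
    rw [hβ.2.1] at this
    exact this.symm

/-- The Riemann-type sum bounding a correlation from above up to the oscillation of `p`. -/
def riemannSum (p : ℝ → ℝ → ℝ) (β γ : ℝ → ℝ) (n : ℕ) : ℝ :=
  ∑ i ∈ Finset.range n, p (β (i / n)) (γ (i / n)) *
    Real.sqrt ((β ((i + 1 : ℕ) / n) - β (i / n)) * (γ ((i + 1 : ℕ) / n) - γ (i / n)))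

theorem exists_correlation_le_riemannSum {p : ℝ → ℝ → ℝ}
    (hp : Continuous fun q : ℝ × ℝ => p q.1 q.2) (hp0 : ∀ x y, 0 ≤ p x y) {ε : ℝ} (hε : 0 < ε) :
    ∃ N : ℕ, ∀ n ≥ N, ∀ β ∈ BalancedPath, ∀ (g h σ : ℝ → ℝ), IsSpeed g → IsSpeed h →
      σ 0 = 0 → σ 1 = 1 → MonotoneOn σ (Icc 0 1) →
      (∀ u ∈ Icc (0:ℝ) 1, prim g (σ u) = β u ∧ prim h (σ u) = complementary β u) →
      correlation p g h ≤ riemannSum p β (complementary β) n + ε := by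
  have huc := (isCompact_Icc.prod isCompact_Icc :
    IsCompact (Icc (0:ℝ) 1 ×ˢ Icc (0:ℝ) 1)).uniformContinuousOn_of_continuous hp.continuousOn
  obtain ⟨δ, hδ, H⟩ := Metric.uniformContinuousOn_iff.1 huc ε hε
  obtain ⟨N, hN⟩ := exists_nat_gt (2 / δ)
  refine ⟨max N 1, fun n hn β hβ g h σ hg hh h0 h1 hσ hprim => ?_⟩
  have hn1 : 1 ≤ n := (le_max_right _ _).trans hn
  have hn0 : (0:ℝ) < n := by exact_mod_cast hn1
  have hnδ : 2 / (n:ℝ) < δ := by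
    rw [div_lt_iff₀ hn0]
    rw [div_lt_iff₀ hδ] at hN
    have : (N:ℝ) ≤ n := by exact_mod_cast (le_max_left _ _).trans hn
    nlinarith
  have hmem : ∀ i : ℕ, i ≤ n → (i / n : ℝ) ∈ Icc (0:ℝ) 1 := fun i hi =>
    ⟨by positivity, (div_le_one hn0).2 (by exact_mod_cast hi)⟩
  have hstep : ∀ i : ℕ, ((i + 1 : ℕ) / n : ℝ) - i / n = 1 / n := fun i => by
    push_cast; ring
  have hlt : ∀ i : ℕ, (i / n : ℝ) ≤ (i + 1 : ℕ) / n := fun i => by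
    have := hstep i
    have : (0:ℝ) < 1 / n := by positivity
    linarith
  have hγ := complementary_mem hβ
  have key := correlation_le_sum hp hp0 hg hh hε.le (n := n) (t := fun i => σ (i / n))
    (by simp [h0]) (by simp [div_self hn0.ne', h1])
    (fun i hi => hσ (hmem i hi.le) (hmem (i + 1) hi) (hlt i)) ?_
  · refine key.trans_eq ?_
    rw [riemannSum]
    congr 1
    refine Finset.sum_congr rfl fun i hi => ?_
    have hi' := Finset.mem_range.1 hi
    have e1 := hprim _ (hmem i hi'.le)
    have e2 := hprim _ (hmem (i + 1) hi')
    simp only [e1.1, e1.2, e2.1, e2.2]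
  · intro i hi s hs
    have e1 := hprim _ (hmem i hi.le)
    have e2 := hprim _ (hmem (i + 1) hi)
    have hs1 : s ∈ Icc (0:ℝ) 1 := by
      constructor
      · refine le_trans ?_ hs.1
        rw [← h0]
        exact hσ (by simp) (hmem i hi.le) (hmem i hi.le).1
      · refine hs.2.trans ?_
        rw [← h1]
        exact hσ (hmem (i + 1) hi) (by simp) (hmem (i + 1) hi).2
    have a1 := hg.monotone_prim hs.1
    have a2 := hg.monotone_prim hs.2
    have b1 := hh.monotone_prim hs.1
    have b2 := hh.monotone_prim hs.2
    simp only [e1.1, e1.2, e2.1, e2.2] at a1 a2 b1 b2 ⊢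
    have a3 := (hβ.2.2 _ _ (hlt i)).2
    have b3 := (hγ.2.2 _ _ (hlt i)).2
    rw [hstep] at a3 b3
    have c : 2 * (1 / (n:ℝ)) = 2 / n := by ring
    have := H (prim g s, prim h s) ⟨hg.prim_mem hs1, hh.prim_mem hs1⟩
      (β (i / n), complementary β (i / n))
      ⟨BalancedPath.mem_Icc hβ (hmem i hi.le), BalancedPath.mem_Icc hγ (hmem i hi.le)⟩ (by
        rw [Prod.dist_eq, max_lt_iff, Real.dist_eq, Real.dist_eq, abs_lt, abs_lt]
        refine ⟨⟨?_, ?_⟩, ?_, ?_⟩ <;> simp only <;> linarith)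
    rw [Real.dist_eq, abs_lt] at this
    simp only at this
    linarith [this.2]

theorem HasDerivAt.tendsto_slope_straddle {ι : Type*} {l : Filter ι} {f : ℝ → ℝ} {D t : ℝ}
    (hf : HasDerivAt f D t) {u v : ι → ℝ} (hu : Tendsto u l (nhds t)) (hv : Tendsto v l (nhds t))
    (hut : ∀ᶠ i in l, u i ≤ t) (htv : ∀ᶠ i in l, t ≤ v i) (huv : ∀ᶠ i in l, u i < v i) :
    Tendsto (fun i => (f (v i) - f (u i)) / (v i - u i)) l (nhds D) := by
  rw [Metric.tendsto_nhds]
  intro ε hε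
  have h1 := (hasDerivAt_iff_isLittleO.1 hf).def (half_pos hε)
  filter_upwards [hu.eventually h1, hv.eventually h1, hut, htv, huv] with i a b c d e
  have hpos : 0 < v i - u i := sub_pos.2 e
  rw [Real.dist_eq, div_sub' hpos.ne', abs_div, abs_of_pos hpos, div_lt_iff₀ hpos]
  simp only [Real.norm_eq_abs, smul_eq_mul] at a b
  rw [abs_of_nonpos (sub_nonpos.2 c), abs_le] at a
  rw [abs_of_nonneg (sub_nonneg.2 d), abs_le] at b
  rw [abs_lt]
  constructor <;> nlinarith

theorem tendsto_riemannSum {p : ℝ → ℝ → ℝ} (hp : Continuous fun q : ℝ × ℝ => p q.1 q.2)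
    {β γ g h : ℝ → ℝ} (hβ : β ∈ BalancedPath) (hγ : γ ∈ BalancedPath) (hg : IsSpeed g)
    (hh : IsSpeed h) (hβg : EqOn β (prim g) (Icc 0 1)) (hγh : EqOn γ (prim h) (Icc 0 1)) :
    Tendsto (riemannSum p β γ) atTop (nhds (correlation p g h)) := by
  obtain ⟨M, hM⟩ := (isCompact_Icc.prod isCompact_Icc :
    IsCompact (Icc (0:ℝ) 1 ×ˢ Icc (0:ℝ) 1)).exists_bound_of_continuousOn hp.continuousOn
  have hcβ := (BalancedPath.lipschitz hβ).continuous
  have hcγ := (BalancedPath.lipschitz hγ).continuous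
  set u : ℕ → ℝ → ℝ := fun n t => (⌊n * t⌋ : ℝ) / n with hu
  set v : ℕ → ℝ → ℝ := fun n t => ((⌊n * t⌋ : ℝ) + 1) / n with hv
  set f : ℕ → ℝ → ℝ := fun n t => p (β (u n t)) (γ (u n t)) *
    Real.sqrt ((β (v n t) - β (u n t)) / (v n t - u n t) *
      ((γ (v n t) - γ (u n t)) / (v n t - u n t))) with hf
  have hvu : ∀ n t, v n t - u n t = 1 / n := fun n t => by simp only [hu, hv]; ring
  have hut : ∀ n t, 0 < n → u n t ≤ t := fun n t hn => by
    have hn0 : (0:ℝ) < n := by exact_mod_cast hn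
    rw [div_le_iff₀ hn0]
    linarith [Int.floor_le ((n:ℝ) * t)]
  have htv : ∀ n t, 0 < n → t < v n t := fun n t hn => by
    have hn0 : (0:ℝ) < n := by exact_mod_cast hn
    rw [lt_div_iff₀ hn0]
    linarith [Int.lt_floor_add_one ((n:ℝ) * t)]
  have hsum : ∀ᶠ n in atTop, ∫ t in (0:ℝ)..1, f n t = riemannSum p β γ n := by
    filter_upwards [eventually_gt_atTop 0] with n hn
    have hn0 : (0:ℝ) < n := by exact_mod_cast hn
    have hfi : ∀ i : ℕ, ∀ᵐ t : ℝ, t ∈ uIoc ((i : ℕ) / n : ℝ) ((i + 1 : ℕ) / n) →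
        n * (p (β (i / n)) (γ (i / n)) *
          Real.sqrt ((β ((i + 1 : ℕ) / n) - β (i / n)) * (γ ((i + 1 : ℕ) / n) - γ (i / n)))) =
          f n t := by
      intro i
      have h1 : ∀ᵐ t : ℝ, t ≠ (i + 1 : ℕ) / n := by simp [ae_iff, measure_singleton]
      filter_upwards [h1] with t ht1 ht
      rw [uIoc_of_le (by gcongr; simp)] at ht
      have hfl : ⌊(n:ℝ) * t⌋ = (i : ℤ) := by
        rw [Int.floor_eq_iff]
        have a := ht.1
        have b := lt_of_le_of_ne ht.2 ht1
        rw [div_lt_iff₀ hn0] at a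
        rw [lt_div_iff₀ hn0] at b
        push_cast at b ⊢
        constructor <;> linarith
      have e1 : u n t = i / n := by simp only [hu, hfl, Int.cast_natCast]
      have e2 : v n t = (i + 1 : ℕ) / n := by
        simp only [hv, hfl, Int.cast_natCast]; push_cast; rfl
      simp only [hf, hvu]
      rw [e1, e2]
      rw [show (β ((i + 1 : ℕ) / n) - β (i / n)) / (1 / (n:ℝ)) *
          ((γ ((i + 1 : ℕ) / n) - γ (i / n)) / (1 / (n:ℝ))) = (n:ℝ) ^ 2 *
          ((β ((i + 1 : ℕ) / n) - β (i / n)) * (γ ((i + 1 : ℕ) / n) - γ (i / n))) by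
        field_simp]
      rw [Real.sqrt_mul (sq_nonneg _), Real.sqrt_sq hn0.le]
      ring
    have hii : ∀ k < n, IntervalIntegrable (f n) volume ((k : ℕ) / n : ℝ) ((k + 1 : ℕ) / n) := by
      intro k _
      exact intervalIntegrable_const.congr_ae ((ae_restrict_iff' measurableSet_uIoc).2 (hfi k))
    have := intervalIntegral.sum_integral_adjacent_intervals hii
    simp only [Nat.cast_zero, zero_div, div_self hn0.ne'] at this
    rw [← this, riemannSum]
    refine Finset.sum_congr rfl fun i _ => ?_
    rw [← intervalIntegral.integral_congr_ae (hfi i), intervalIntegral.integral_const, smul_eq_mul,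
      show ((i + 1 : ℕ) / n : ℝ) - i / n = 1 / n by push_cast; ring]
    field_simp
  refine Tendsto.congr' hsum ?_
  have hone : ∀ᵐ t : ℝ, t ≠ 1 := by simp [ae_iff, measure_singleton]
  refine intervalIntegral.tendsto_integral_filter_of_dominated_convergence (fun _ => M * 2) ?_ ?_
    intervalIntegrable_const ?_
  · refine Eventually.of_forall fun n => Measurable.aestronglyMeasurable ?_
    have hum : Measurable (u n) := by simp only [hu]; fun_prop
    have hvm : Measurable (v n) := by simp only [hv]; fun_prop
    have m1 := hcβ.measurable.comp hum
    have m2 := hcβ.measurable.comp hvm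
    have m3 := hcγ.measurable.comp hum
    have m4 := hcγ.measurable.comp hvm
    exact (hp.measurable.comp (m1.prodMk m3)).mul
      ((((m2.sub m1).div (hvm.sub hum)).mul ((m4.sub m3).div (hvm.sub hum))).sqrt)
  · filter_upwards [eventually_gt_atTop 0] with n hn
    filter_upwards [hone] with t ht1 ht
    rw [uIoc_of_le zero_le_one] at ht
    have hn0 : (0:ℝ) < n := by exact_mod_cast hn
    have hu0 : 0 ≤ u n t := by
      have : (0:ℝ) ≤ (⌊(n:ℝ) * t⌋ : ℝ) := by
        exact_mod_cast Int.floor_nonneg.2 (mul_nonneg hn0.le ht.1.le)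
      simp only [hu]; positivity
    have hum : u n t ∈ Icc (0:ℝ) 1 := ⟨hu0, (hut n t hn).trans ht.2⟩
    have b1 := hM (β (u n t), γ (u n t)) ⟨BalancedPath.mem_Icc hβ hum, BalancedPath.mem_Icc hγ hum⟩
    have hpos : 0 < v n t - u n t := by rw [hvu]; positivity
    have c1 := hβ.2.2 (u n t) (v n t) (sub_pos.1 hpos).le
    have c2 := hγ.2.2 (u n t) (v n t) (sub_pos.1 hpos).le
    have d1 := div_nonneg c1.1 hpos.le
    have d2 := div_nonneg c2.1 hpos.le
    have e1 := (div_le_iff₀ hpos).2 c1.2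
    have e2 := (div_le_iff₀ hpos).2 c2.2
    simp only [hf, norm_mul]
    refine mul_le_mul b1 ?_ (norm_nonneg _) ((norm_nonneg _).trans b1)
    rw [Real.norm_of_nonneg (Real.sqrt_nonneg _)]
    exact Real.sqrt_le_iff.2 ⟨by norm_num, by nlinarith⟩
  · filter_upwards [hone, hg.ae_hasDerivAt_prim, hh.ae_hasDerivAt_prim] with t ht1 h1 h2 ht
    rw [uIoc_of_le zero_le_one] at ht
    have ht' : t ∈ Ioo (0:ℝ) 1 := ⟨ht.1, lt_of_le_of_ne ht.2 ht1⟩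
    have hmem := Ioo_subset_Icc_self ht'
    have hnb := isOpen_Ioo.mem_nhds ht'
    have h1' : HasDerivAt β (g t) t := h1.congr_of_eventuallyEq <| by
      filter_upwards [hnb] with s hs using hβg (Ioo_subset_Icc_self hs)
    have h2' : HasDerivAt γ (h t) t := h2.congr_of_eventuallyEq <| by
      filter_upwards [hnb] with s hs using hγh (Ioo_subset_Icc_self hs)
    have hinv : Tendsto (fun n : ℕ => 1 / (n:ℝ)) atTop (nhds 0) :=
      tendsto_one_div_atTop_nhds_zero_nat
    have hut' : ∀ᶠ n in atTop, u n t ≤ t := by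
      filter_upwards [eventually_gt_atTop 0] with n hn using hut n t hn
    have htv' : ∀ᶠ n in atTop, t ≤ v n t := by
      filter_upwards [eventually_gt_atTop 0] with n hn using (htv n t hn).le
    have huv' : ∀ᶠ n in atTop, u n t < v n t := by
      filter_upwards [eventually_gt_atTop 0] with n hn using (hut n t hn).trans_lt (htv n t hn)
    have hulim : Tendsto (fun n => u n t) atTop (nhds t) := by
      refine tendsto_of_tendsto_of_tendsto_of_le_of_le' (g := fun n : ℕ => t - 1 / (n:ℝ))
        (by simpa using tendsto_const_nhds.sub hinv) tendsto_const_nhds ?_ hut'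
      filter_upwards [htv'] with n hn
      linarith [hvu n t]
    have hvlim : Tendsto (fun n => v n t) atTop (nhds t) := by
      refine tendsto_of_tendsto_of_tendsto_of_le_of_le' (h := fun n : ℕ => t + 1 / (n:ℝ))
        tendsto_const_nhds (by simpa using tendsto_const_nhds.add hinv) htv' ?_
      filter_upwards [hut'] with n hn
      linarith [hvu n t]
    rw [← hβg hmem, ← hγh hmem]
    refine Tendsto.mul ?_ ?_
    · exact (hp.tendsto (β t, γ t)).comp
        (((hcβ.tendsto t).comp hulim).prodMk_nhds ((hcγ.tendsto t).comp hulim))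
    · exact (Real.continuous_sqrt.tendsto _).comp
        ((h1'.tendsto_slope_straddle hulim hvlim hut' htv' huv').mul
          (h2'.tendsto_slope_straddle hulim hvlim hut' htv' huv'))

theorem continuous_riemannSum {p : ℝ → ℝ → ℝ} (hp : Continuous fun q : ℝ × ℝ => p q.1 q.2)
    (n : ℕ) : Continuous fun β : ℝ → ℝ => riemannSum p β (complementary β) n := by
  unfold riemannSum complementary
  refine continuous_finsetSum _ fun i _ => Continuous.mul ?_ ?_
  · exact hp.comp (f := fun β : ℝ → ℝ => (β (i / n), 2 * (i / n) - β (i / n))) (by fun_prop)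
  · fun_prop

/-- Any pair of speeds can be reparametrised to a balanced path. -/
theorem exists_balancedPath_of_speed {g h : ℝ → ℝ} (hg : IsSpeed g) (hh : IsSpeed h) :
    ∃ β ∈ BalancedPath, ∃ σ : ℝ → ℝ, σ 0 = 0 ∧ σ 1 = 1 ∧ MonotoneOn σ (Icc 0 1) ∧
      ∀ u ∈ Icc (0:ℝ) 1, prim g (σ u) = β u ∧ prim h (σ u) = complementary β u := by
  have hex : ∀ u : ℝ, ∃ s : ℝ, u ∈ Icc (0:ℝ) 1 → prim g s + prim h s = 2 * u ∧
      s ∈ Icc (0:ℝ) 1 ∧ (u = 0 → s = 0) ∧ (u = 1 → s = 1) := by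
    intro u
    rcases eq_or_ne u 0 with rfl | h0
    · exact ⟨0, fun _ => by simp [prim_zero]⟩
    rcases eq_or_ne u 1 with rfl | h1
    · exact ⟨1, fun _ => ⟨by rw [hg.prim_one, hh.prim_one]; norm_num, by simp⟩⟩
    by_cases hu : u ∈ Icc (0:ℝ) 1
    · have := intermediate_value_Icc zero_le_one
        (hg.continuous_prim.add hh.continuous_prim).continuousOn
      obtain ⟨s, hs, e⟩ := this (show 2 * u ∈ _ by
        simp only [Pi.add_apply, prim_zero, hg.prim_one, hh.prim_one]
        constructor <;> linarith [hu.1, hu.2])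
      exact ⟨s, fun _ => ⟨e, hs, fun h => absurd h h0, fun h => absurd h h1⟩⟩
    · exact ⟨0, fun h => absurd h hu⟩
  choose σ hσ using hex
  have hm0 : (0:ℝ) ∈ Icc (0:ℝ) 1 := by simp
  have hm1 : (1:ℝ) ∈ Icc (0:ℝ) 1 := by simp
  have s0 : σ 0 = 0 := (hσ 0 hm0).2.2.1 rfl
  have s1 : σ 1 = 1 := (hσ 1 hm1).2.2.2 rfl
  have hmono : MonotoneOn σ (Icc 0 1) := by
    intro u hu v hv huv
    by_contra! hlt
    have a := hg.monotone_prim hlt.le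
    have b := hh.monotone_prim hlt.le
    have c := (hσ u hu).1
    have d := (hσ v hv).1
    have e : u = v := by linarith
    subst e
    exact lt_irrefl _ hlt
  refine ⟨clampExt fun u => prim g (σ u), ⟨?_, ?_, ?_⟩, σ, s0, s1, hmono, ?_⟩
  · rw [clampExt_of_mem _ hm0, s0, prim_zero]
  · rw [clampExt_of_mem _ hm1, s1, hg.prim_one]
  · intro u v huv
    have hmem : ∀ x : ℝ, max 0 (min 1 x) ∈ Icc (0:ℝ) 1 := fun x =>
      ⟨le_max_left _ _, max_le zero_le_one (min_le_left _ _)⟩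
    have hle : max 0 (min 1 u) ≤ max 0 (min 1 v) := by gcongr
    have hlip : max 0 (min 1 v) - max 0 (min 1 u) ≤ v - u := by
      rcases le_total 1 u with h1 | h1 <;> rcases le_total 1 v with h2 | h2 <;>
        rcases le_total 0 u with h3 | h3 <;> rcases le_total 0 v with h4 | h4 <;>
        simp [*] <;> linarith
    have a := hg.monotone_prim (hmono (hmem u) (hmem v) hle)
    have b := hh.monotone_prim (hmono (hmem u) (hmem v) hle)
    have c := (hσ _ (hmem u)).1
    have d := (hσ _ (hmem v)).1
    simp only [clampExt]
    constructor <;> linarith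
  · intro u hu
    rw [complementary, clampExt_of_mem _ hu]
    exact ⟨rfl, by linarith [(hσ u hu).1]⟩

theorem exists_balancedPath_max {p : ℝ → ℝ → ℝ} (hp : Continuous fun q : ℝ × ℝ => p q.1 q.2)
    (hp0 : ∀ x y, 0 ≤ p x y) : ∃ β ∈ BalancedPath, ∀ g h, IsSpeed g → IsSpeed h →
      correlation p g h ≤ correlation p (speed β) (speed (complementary β)) := by
  set J : (ℝ → ℝ) → ℝ := fun β => correlation p (speed β) (speed (complementary β)) with hJ
  have hlim : ∀ β ∈ BalancedPath,
      Tendsto (riemannSum p β (complementary β)) atTop (nhds (J β)) := fun β hβ =>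
    tendsto_riemannSum hp hβ (complementary_mem hβ) (BalancedPath.isSpeed hβ)
      (BalancedPath.isSpeed (complementary_mem hβ)) (BalancedPath.prim_speed hβ)
      (BalancedPath.prim_speed (complementary_mem hβ))
  have husc : UpperSemicontinuousOn J BalancedPath := by
    intro β hβ y hy
    obtain ⟨N, hN⟩ := exists_correlation_le_riemannSum hp hp0 (show 0 < (y - J β) / 2 by linarith)
    obtain ⟨n, hn, hnN⟩ := (((hlim β hβ).eventually_lt_const
      (show J β < (J β + y) / 2 by linarith)).and (eventually_ge_atTop N)).exists
    have := (continuous_riemannSum hp n).continuousAt.eventually_lt_const hn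
    filter_upwards [nhdsWithin_le_nhds this, self_mem_nhdsWithin] with β' h1 h2
    have h3 := hN n hnN β' h2 _ _ id (BalancedPath.isSpeed h2)
      (BalancedPath.isSpeed (complementary_mem h2)) rfl rfl (monotone_id.monotoneOn _) fun u hu =>
      ⟨(BalancedPath.prim_speed h2 hu).symm,
        (BalancedPath.prim_speed (complementary_mem h2) hu).symm⟩
    change J β' ≤ _ at h3
    linarith
  obtain ⟨β, hβ, hmax⟩ := husc.exists_isMaxOn ⟨id, id_mem_balancedPath⟩ isCompact_balancedPath
  refine ⟨β, hβ, fun g h hg hh => ?_⟩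
  obtain ⟨β', hβ', σ, s0, s1, hσ, hprim⟩ := exists_balancedPath_of_speed hg hh
  refine le_trans ?_ (hmax hβ')
  refine le_of_forall_pos_le_add fun ε hε => ?_
  obtain ⟨N, hN⟩ := exists_correlation_le_riemannSum hp hp0 hε
  refine ge_of_tendsto ((hlim β' hβ').add_const ε) ?_
  filter_upwards [eventually_ge_atTop N] with n hn
  exact hN n hn β' hβ' g h σ hg hh s0 s1 hσ hprim

theorem BalancedPath.ae_hasDerivAt_speed {β : ℝ → ℝ} (hβ : β ∈ BalancedPath) :
    ∀ᵐ t, t ∈ Ioo (0:ℝ) 1 → HasDerivAt β (speed β t) t := by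
  filter_upwards [(BalancedPath.isSpeed hβ).ae_hasDerivAt_prim] with t h ht
  refine h.congr_of_eventuallyEq ?_
  filter_upwards [isOpen_Ioo.mem_nhds ht] with s hs
  exact BalancedPath.prim_speed hβ (Ioo_subset_Icc_self hs)

theorem HasDerivAt.eq_zero_or_two_of_eq_min {f : ℝ → ℝ} {D t k l : ℝ} (hf : HasDerivAt f D t)
    (h : ∀ᶠ s in nhds t, f s = min (2 * s - k) l) : D = 0 ∨ D = 2 := by
  have ht := h.self_of_nhds
  rcases le_or_gt (2 * t - k) l with hle | hlt
  · right
    have h1 : HasDerivWithinAt (fun s : ℝ => 2 * s - k) 2 (Iic t) t := by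
      simpa using ((hasDerivAt_id t).const_mul 2).sub_const k |>.hasDerivWithinAt (s := Iic t)
    have h2 : HasDerivWithinAt f 2 (Iic t) t := by
      refine h1.congr_of_eventuallyEq ?_ (by rw [ht, min_eq_left hle])
      filter_upwards [nhdsWithin_le_nhds h, self_mem_nhdsWithin] with s hs hst
      rw [hs, min_eq_left]
      linarith [mem_Iic.1 hst]
    exact (uniqueDiffWithinAt_Iic t).eq_deriv _ hf.hasDerivWithinAt h2
  · left
    refine hf.unique ((hasDerivAt_const t l).congr_of_eventuallyEq ?_)
    have h3 : ∀ᶠ s in nhds t, l < 2 * s - k :=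
      (show ContinuousAt (fun s : ℝ => 2 * s - k) t by fun_prop).eventually_const_lt hlt
    filter_upwards [h, h3] with s hs hs'
    rw [hs, min_eq_right hs'.le]

theorem ae_deriv_eq_of_eqOn {f g f' g' : ℝ → ℝ} {C : Set ℝ} (h : EqOn f g C) :
    ∀ᵐ t : ℝ, t ∈ C → HasDerivAt f (f' t) t → HasDerivAt g (g' t) t → f' t = g' t := by
  have hc := (countable_setOfPred_isolated_right_within (s := C)).measure_zero volume
  filter_upwards [measure_eq_zero_iff_ae_notMem.1 hc] with t ht htC hf hg
  have hne : (nhdsWithin t (C ∩ Ioi t)).NeBot := ⟨fun hbot => ht ⟨htC, hbot⟩⟩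
  have hnot : t ∉ C ∩ Ioi t := fun hm => lt_irrefl t (mem_Ioi.1 hm.2)
  have h1 := (hasDerivWithinAt_iff_tendsto_slope' hnot).1 hf.hasDerivWithinAt
  have h2 := (hasDerivWithinAt_iff_tendsto_slope' hnot).1 hg.hasDerivWithinAt
  refine tendsto_nhds_unique h1 (h2.congr' ?_)
  filter_upwards [self_mem_nhdsWithin] with s hs
  rw [slope_def_field, slope_def_field, h hs.1, h htC]

/-- A balanced path can be replaced by a path moving in one coordinate at a time off a closed set
of parameters. -/
theorem exists_staircase {β : ℝ → ℝ} (hβ : β ∈ BalancedPath) {C : Set ℝ} (hC : IsClosed C)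
    (h0 : Iic 0 ⊆ C) (h1 : Ici 1 ⊆ C) :
    ∃ β' ∈ BalancedPath, EqOn β' β C ∧
      ∀ t ∉ C, ∃ k l : ℝ, ∀ᶠ s in nhds t, β' s = min (2 * s - k) l := by
  have hexa : ∀ t : ℝ, ∃ a ∈ C, a ≤ t ∧ ∀ s ∈ C, s ≤ t → s ≤ a := by
    intro t
    have hne : (C ∩ Iic t).Nonempty :=
      ⟨min 0 t, h0 (mem_Iic.2 (min_le_left 0 t)), mem_Iic.2 (min_le_right 0 t)⟩
    have hbd : BddAbove (C ∩ Iic t) := ⟨t, fun s hs => hs.2⟩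
    have hm := (hC.inter isClosed_Iic).csSup_mem hne hbd
    exact ⟨_, hm.1, hm.2, fun s hs hst => le_csSup hbd ⟨hs, hst⟩⟩
  have hexb : ∀ t : ℝ, ∃ b ∈ C, t ≤ b ∧ ∀ s ∈ C, t ≤ s → b ≤ s := by
    intro t
    have hne : (C ∩ Ici t).Nonempty :=
      ⟨max 1 t, h1 (mem_Ici.2 (le_max_left 1 t)), mem_Ici.2 (le_max_right 1 t)⟩
    have hbd : BddBelow (C ∩ Ici t) := ⟨t, fun s hs => hs.2⟩
    have hm := (hC.inter isClosed_Ici).csInf_mem hne hbd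
    exact ⟨_, hm.1, hm.2, fun s hs hst => csInf_le hbd ⟨hs, hst⟩⟩
  choose a haC hat ha using hexa
  choose b hbC htb hb using hexb
  set γ := complementary β with hγ
  have hγm := complementary_mem hβ
  have hsum : ∀ t, β t + γ t = 2 * t := fun t => by simp only [hγ, complementary]; ring
  set β' : ℝ → ℝ := fun t => min (2 * t - γ (a t)) (β (b t)) with hβ'
  have heq : EqOn β' β C := by
    intro t ht
    have e1 : a t = t := le_antisymm (hat t) (ha t t ht le_rfl)
    have e2 : b t = t := le_antisymm (hb t t ht le_rfl) (htb t)
    simp only [hβ', e1, e2]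
    rw [show 2 * t - γ t = β t by linarith [hsum t], min_self]
  have hloc : ∀ t s, a t < s → s < b t → t ∉ C → a s = a t ∧ b s = b t := by
    intro t s has hsb ht
    have hs1 : a s ≤ t := by
      by_contra! hlt
      linarith [hb t _ (haC s) hlt.le, hat s]
    have hs2 : t ≤ b s := by
      by_contra! hlt
      linarith [ha t _ (hbC s) hlt.le, htb s]
    exact ⟨le_antisymm (ha t _ (haC s) hs1) (ha s _ (haC t) has.le),
      le_antisymm (hb s _ (hbC t) hsb.le) (hb t _ (hbC s) hs2)⟩
  have hnot : ∀ t ∉ C, a t < t ∧ t < b t := fun t ht =>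
    ⟨lt_of_le_of_ne (hat t) fun e => ht (e ▸ haC t),
      lt_of_le_of_ne (htb t) fun e => ht (e ▸ hbC t)⟩
  have hleft : ∀ u, ∀ c ∈ C, u ≤ c → 0 ≤ β c - β' u ∧ β c - β' u ≤ 2 * (c - u) := by
    intro u c hc huc
    have hbc := hb u c hc huc
    have hab : a u ≤ c := (hat u).trans huc
    have m1 := hβ.2.2 _ _ hbc
    have m2 := BalancedPath.monotone hγm hab
    have m3 := htb u
    have m4 := hsum c
    constructor
    · linarith [min_le_right (2 * u - γ (a u)) (β (b u))]
    · have : β c - 2 * (c - u) ≤ β' u := le_min (by linarith) (by linarith)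
      linarith
  have hright : ∀ v, ∀ c ∈ C, c ≤ v → 0 ≤ β' v - β c ∧ β' v - β c ≤ 2 * (v - c) := by
    intro v c hc hcv
    have hca := ha v c hc hcv
    have m1 := BalancedPath.monotone hβ hca
    have m2 := BalancedPath.monotone hγm hca
    have m3 := BalancedPath.monotone hβ (hcv.trans (htb v))
    have m4 := hsum c
    have m5 := hsum (a v)
    have m6 := hat v
    constructor
    · have : β c ≤ β' v := le_min (by linarith) m3
      linarith
    · linarith [min_le_left (2 * v - γ (a v)) (β (b v))]
  refine ⟨β', ⟨?_, ?_, ?_⟩, heq, ?_⟩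
  · rw [heq (h0 (by simp)), hβ.1]
  · rw [heq (h1 (by simp)), hβ.2.1]
  · intro u v huv
    by_cases hc : ∃ c ∈ C, u ≤ c ∧ c ≤ v
    · obtain ⟨c, hcC, huc, hcv⟩ := hc
      have p1 := hleft u c hcC huc
      have p2 := hright v c hcC hcv
      constructor <;> linarith
    · push Not at hc
      have huC : u ∉ C := fun hu => (hc u hu le_rfl).not_ge huv
      have hvb : v < b u := hc _ (hbC u) (htb u)
      obtain ⟨e1, e2⟩ := hloc u v ((hnot u huC).1.trans_le huv) hvb huC
      simp only [hβ', e1, e2]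
      constructor
      · have : min (2 * u - γ (a u)) (β (b u)) ≤ min (2 * v - γ (a u)) (β (b u)) := by gcongr
        linarith
      · have : min (2 * v - γ (a u)) (β (b u)) - 2 * (v - u) ≤
            min (2 * u - γ (a u)) (β (b u)) :=
          le_min (by linarith [min_le_left (2 * v - γ (a u)) (β (b u))])
            (by linarith [min_le_right (2 * v - γ (a u)) (β (b u))])
        linarith
  · intro t ht
    refine ⟨γ (a t), β (b t), ?_⟩
    filter_upwards [isOpen_Ioo.mem_nhds (hnot t ht)] with s hs
    obtain ⟨e1, e2⟩ := hloc t s hs.1 hs.2 ht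
    simp only [hβ', e1, e2]

theorem exists_correlation_max {ψ : ℝ → ℝ → ℝ} (hψ : Continuous fun q : ℝ × ℝ => ψ q.1 q.2) :
    ∃ g h, IsSpeed g ∧ IsSpeed h ∧ ∀ g' h', IsSpeed g' → IsSpeed h' →
      correlation ψ g' h' ≤ correlation ψ g h := by
  set p : ℝ → ℝ → ℝ := fun x y => max (ψ x y) 0 with hp_def
  have hp : Continuous fun q : ℝ × ℝ => p q.1 q.2 := hψ.max continuous_const
  obtain ⟨β, hβ, hmax⟩ := exists_balancedPath_max hp fun x y => le_max_right _ _
  have hcβ := (BalancedPath.lipschitz hβ).continuous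
  have hcγ := (BalancedPath.lipschitz (complementary_mem hβ)).continuous
  set C : Set ℝ := {t | 0 ≤ ψ (β t) (complementary β t)} ∪ Iic 0 ∪ Ici 1 with hC_def
  have hC : IsClosed C :=
    ((isClosed_le continuous_const (hψ.comp (hcβ.prodMk hcγ))).union isClosed_Iic).union
      isClosed_Ici
  obtain ⟨β', hβ', heq, hmin⟩ := exists_staircase hβ hC
    (fun t ht => Or.inl (Or.inr ht)) fun t ht => Or.inr ht
  have hγ := complementary_mem hβ
  have hγ' := complementary_mem hβ'
  have heqc : EqOn (complementary β') (complementary β) C := fun t ht => by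
    simp only [complementary, heq ht]
  have hg := BalancedPath.isSpeed hβ'
  have hh := BalancedPath.isSpeed hγ'
  refine ⟨speed β', speed (complementary β'), hg, hh, fun g' h' hg' hh' => ?_⟩
  have e : correlation ψ (speed β') (speed (complementary β')) =
      correlation p (speed β) (speed (complementary β)) := by
    refine intervalIntegral.integral_congr_ae ?_
    have hone : ∀ᵐ t : ℝ, t ≠ 1 := by simp [ae_iff, measure_singleton]
    filter_upwards [hone, BalancedPath.ae_hasDerivAt_speed hβ,
      BalancedPath.ae_hasDerivAt_speed hγ, BalancedPath.ae_hasDerivAt_speed hβ',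
      BalancedPath.ae_hasDerivAt_speed hγ', ae_deriv_eq_of_eqOn heq, ae_deriv_eq_of_eqOn heqc]
      with t ht1 d1 d2 d3 d4 e1 e2 ht
    rw [uIoc_of_le zero_le_one] at ht
    have ht' : t ∈ Ioo (0:ℝ) 1 := ⟨ht.1, lt_of_le_of_ne ht.2 ht1⟩
    have hm := Ioo_subset_Icc_self ht'
    rw [← BalancedPath.prim_speed hβ hm, ← BalancedPath.prim_speed hγ hm,
      ← BalancedPath.prim_speed hβ' hm, ← BalancedPath.prim_speed hγ' hm]
    by_cases htC : t ∈ C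
    · rw [e1 htC (d3 ht') (d1 ht'), e2 htC (d4 ht') (d2 ht'), heq htC, heqc htC]
      have hpos : 0 ≤ ψ (β t) (complementary β t) := by
        rcases htC with (h | h) | h
        · exact h
        · exact absurd ht'.1 (not_lt.2 h)
        · exact absurd ht'.2 (not_lt.2 h)
      simp only [hp_def, max_eq_left hpos]
    · have hneg : ψ (β t) (complementary β t) ≤ 0 := by
        by_contra! hlt
        exact htC (Or.inl (Or.inl hlt.le))
      have hsum : speed (complementary β') t = 2 - speed β' t := by
        refine (d4 ht').unique ?_
        have h := ((hasDerivAt_id t).const_mul 2).sub (d3 ht')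
        rw [mul_one] at h
        exact h
      obtain ⟨k, l, hkl⟩ := hmin t htC
      have hzero : speed β' t * speed (complementary β') t = 0 := by
        rw [hsum]
        rcases (d3 ht').eq_zero_or_two_of_eq_min hkl with h | h <;> rw [h] <;> ring
      simp only [hp_def, max_eq_right hneg, hzero, Real.sqrt_zero, mul_zero, zero_mul]
  rw [e]
  refine le_trans ?_ (hmax g' h' hg' hh')
  exact intervalIntegral.integral_mono_on zero_le_one
    (intervalIntegrable_correlation hψ hg' hh' 0 1) (intervalIntegrable_correlation hp hg' hh' 0 1)
    fun t _ => mul_le_mul_of_nonneg_right (le_max_left _ _) (Real.sqrt_nonneg _)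

/-- if `b, c` are `C¹` curves on `[0,1]` with `b 0 = c 0 = 0` (i.e. curves in
`AC₀([0,1],ℝ^d)` whose derivatives `fb, fc` are continuous on `[0,1]`) and `b' ≠ 0`, `c' ≠ 0`
a.e., then there exist `β, γ ∈ Γ̄` realising the infimum defining the quotient distance:
`dist(b ∘ β, c ∘ γ) = inf_{β',γ' ∈ Γ̄} dist(b ∘ β', c ∘ γ')`. -/
theorem stmt_18 (d : ℕ) (b c : ℝ → E d) (fb fc : ℝ → E d)
    (hb : IsACDeriv b fb) (hc : IsACDeriv c fc)
    (hfb : ContinuousOn fb (Icc (0:ℝ) 1)) (hfc : ContinuousOn fc (Icc (0:ℝ) 1))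
    (hb0 : ∀ᵐ t ∂(volume.restrict (Icc (0:ℝ) 1)), fb t ≠ 0)
    (hc0 : ∀ᵐ t ∂(volume.restrict (Icc (0:ℝ) 1)), fc t ≠ 0) :
    ∃ β γ : ℝ → ℝ, MemGammaBar β ∧ MemGammaBar γ ∧
      SRVdist (b ∘ β) (c ∘ γ) = QD b c := by
  have hψ : Continuous fun q : ℝ × ℝ =>
      inner ℝ (V (clampExt fb q.1)) (V (clampExt fc q.2)) :=
    (continuous_V.comp ((continuous_clampExt hfb).comp continuous_fst)).inner
      (continuous_V.comp ((continuous_clampExt hfc).comp continuous_snd))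
  obtain ⟨g, h, hg, hh, hmax⟩ := exists_correlation_max
    (ψ := fun x y => inner ℝ (V (clampExt fb x)) (V (clampExt fc y))) hψ
  refine ⟨prim g, prim h, hg.memGammaBar, hh.memGammaBar, ?_⟩
  rw [QD]
  refine Eq.symm (IsLeast.csInf_eq (And.intro ⟨_, _, hg.memGammaBar, hh.memGammaBar, rfl⟩ ?_))
  rintro r ⟨β, γ, hβ, hγ, rfl⟩
  obtain ⟨g', hg', hβg⟩ := hβ.exists_isSpeed
  obtain ⟨h', hh', hγh⟩ := hγ.exists_isSpeed
  rw [SRVdist_comp hb hc hfb hfc hg (fun _ _ => rfl) hh (fun _ _ => rfl),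
    SRVdist_comp hb hc hfb hfc hg' hβg hh' hγh]
  exact Real.sqrt_le_sqrt (by linarith [hmax g' h' hg' hh'])
end
end
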